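/- arXiv:math/0407096 — 4 statements merged into one kernel-verified Lean document; each statement's English description precedes it below -/
import Mathlib

section
/- The geometry group G(A) of associativity is isomorphic to Thompson's group F, i.e., to the group of orientation-preserving piecewise linear homeomorphisms of the unit interval [0,1] whose breakpoints occur at dyadic rational numbers and whose slopes are integer powers of 2. -/
/-- Coloured trees: finite rooted binary trees whose leaves are labelled by
positive integers. -/
inductive CTree : Type
  | leaf : ℕ+ → CTree
  | node : CTree → CTree → CTree

/-- Partial maps on coloured trees, as a monoid under reversed composition:
`(f * g) t = (f t).bind g`, i.e. `f * g` means "`f` then `g`". -/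
abbrev PMap : Type := CTree → Option CTree

instance : Monoid PMap where
  one := fun t => some t
  mul f g := fun t => (f t).bind g
  mul_assoc f g h := by
    funext t
    show ((f t).bind g).bind h = (f t).bind fun u => (g u).bind h
    cases f t <;> rfl
  one_mul f := rfl
  mul_one f := by
    funext t
    show (f t).bind some = f t
    cases f t <;> rfl

/-- The associativity operator `A`: maps `t₁·(t₂·t₃)` to `(t₁·t₂)·t₃`. -/
def opA : PMap
  | .node t₁ (.node t₂ t₃) => some (.node (.node t₁ t₂) t₃)
  | _ => none

/-- The inverse partial map of `A`: maps `(t₁·t₂)·t₃` to `t₁·(t₂·t₃)`. -/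
def opAi : PMap
  | .node (.node t₁ t₂) t₃ => some (.node t₁ (.node t₂ t₃))
  | _ => none

/-- The commutativity operator `C`: maps `t₁·t₂` to `t₂·t₁` (its own inverse
as a partial map). -/
def opC : PMap
  | .node t₁ t₂ => some (.node t₂ t₁)
  | _ => none

/-- The semi-commutativity operator `S`: maps `t₁·(t₂·t₃)` to `t₂·(t₁·t₃)`
(its own inverse as a partial map). -/
def opS : PMap
  | .node t₁ (.node t₂ t₃) => some (.node t₂ (.node t₁ t₃))
  | _ => none

/-- Addresses: finite words over `{0,1}`, with `false` = 0 (left) and `true` = 1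
(right). -/
abbrev Addr := List Bool

/-- `applyAt α f` is the shifted operator `∂_α f`, applying `f` to the
`α`-subtree of its argument. -/
def applyAt : Addr → PMap → PMap
  | [], f => f
  | false :: α, f => fun t => match t with
      | .node t₁ t₂ => (applyAt α f t₁).map (fun s => .node s t₂)
      | _ => none
  | true :: α, f => fun t => match t with
      | .node t₁ t₂ => (applyAt α f t₂).map (fun s => .node t₁ s)
      | _ => none

/-- Two partial maps are near-equal if they are both defined on at least one common
element, and they agree wherever both are defined. -/
def NearEq (f g : PMap) : Prop :=
  (∃ t, (f t).isSome ∧ (g t).isSome) ∧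
  ∀ t, (f t).isSome → (g t).isSome → f t = g t

/-- The generators of the geometry monoid of associativity: the operators `A_α`
and their inverse partial maps. -/
def genA : Set PMap := {f | ∃ α : Addr, f = applyAt α opA ∨ f = applyAt α opAi}

/-- The geometry monoid `𝒢(A)` of associativity. -/
def GeoA : Submonoid PMap := Submonoid.closure genA

/-- Thompson's group `F`, as a set of permutations of `[0,1]`: the
orientation-preserving (strictly increasing) piecewise linear bijections of `[0,1]`
whose breakpoints are dyadic rationals and whose slopes are integer powers of 2. -/
def IsThompsonF (f : Equiv.Perm (Set.Icc (0:ℝ) 1)) : Prop :=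
  StrictMono f ∧
  ∃ (n : ℕ) (x : Fin (n + 1) → ℝ),
    x 0 = 0 ∧ x (Fin.last n) = 1 ∧ StrictMono x ∧
    (∀ i, ∃ (a : ℤ) (b : ℕ), x i = (a : ℝ) / 2 ^ b) ∧
    ∀ i : Fin n, ∃ (k : ℤ) (cst : ℝ), ∀ t : Set.Icc (0:ℝ) 1,
      x i.castSucc ≤ (t : ℝ) → (t : ℝ) ≤ x i.succ →
        ((f t : ℝ)) = 2 ^ k * (t : ℝ) + cst

namespace CTree

/-- The list of leaf labels. -/
def leaves : CTree → List ℕ+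
  | leaf a => [a]
  | node l r => leaves l ++ leaves r

/-- The number of leaves. -/
def sz : CTree → ℕ
  | leaf _ => 1
  | node l r => sz l + sz r

/-- The piecewise linear map sending the leaf intervals of the tree to unit intervals. -/
noncomputable def bet : CTree → ℝ → ℝ
  | leaf _, x => x
  | node l r, x => if x ≤ 1/2 then bet l (2*x) else sz l + bet r (2*x-1)

/-- The inverse of `bet`. -/
noncomputable def gam : CTree → ℝ → ℝ
  | leaf _, x => x
  | node l r, y => if y ≤ sz l then gam l y / 2 else (gam r (y - sz l) + 1) / 2

theorem length_leaves (t : CTree) : t.leaves.length = t.sz := by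
  induction t with
  | leaf a => rfl
  | node l r hl hr => simp [leaves, sz, hl, hr]

theorem sz_pos (t : CTree) : 0 < t.sz := by
  induction t with
  | leaf a => simp [sz]
  | node l r hl hr => simp [sz, hl]

theorem bet_zero (t : CTree) : t.bet 0 = 0 := by
  induction t with
  | leaf a => rfl
  | node l r hl hr => simp [bet, hl]

theorem bet_one (t : CTree) : t.bet 1 = t.sz := by
  induction t with
  | leaf a => simp [bet, sz]
  | node l r hl hr =>
    have : ¬ (1:ℝ) ≤ 1/2 := by norm_num
    simp only [bet, sz, if_neg this]
    norm_num [hr]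

theorem bet_strictMono (t : CTree) : StrictMono t.bet := by
  induction t with
  | leaf a => exact fun x y h => h
  | node l r hl hr =>
    intro x y h
    simp only [bet]
    split_ifs with h1 h2 h2
    · exact hl (by linarith)
    · have a := hl.monotone (show 2*x ≤ 1 by linarith)
      have b := hr (show 0 < 2*y-1 by linarith)
      rw [bet_one] at a; rw [bet_zero] at b; linarith
    · linarith
    · have b := hr (show 2*x-1 < 2*y-1 by linarith)
      linarith

theorem bet_gam (t : CTree) (y : ℝ) : t.bet (t.gam y) = y := by
  induction t generalizing y with
  | leaf a => rfl
  | node l r hl hr =>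
    simp only [gam]
    split_ifs with h
    · have : l.gam y ≤ 1 := by
        rw [← l.bet_strictMono.le_iff_le, hl, bet_one]; exact h
      rw [bet, if_pos (by linarith), show 2 * (l.gam y / 2) = l.gam y by ring, hl]
    · have : 0 < r.gam (y - l.sz) := by
        rw [← r.bet_strictMono.lt_iff_lt, hr, bet_zero]; linarith
      rw [bet, if_neg (by linarith),
        show 2 * ((r.gam (y - l.sz) + 1) / 2) - 1 = r.gam (y - l.sz) by ring, hr]
      ring

theorem gam_bet (t : CTree) (x : ℝ) : t.gam (t.bet x) = x :=
  t.bet_strictMono.injective (t.bet_gam _)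

theorem gam_strictMono (t : CTree) : StrictMono t.gam := by
  intro x y h
  rw [← t.bet_strictMono.lt_iff_lt, bet_gam, bet_gam]; exact h

theorem gam_zero (t : CTree) : t.gam 0 = 0 := by
  rw [← t.bet_zero, gam_bet, bet_zero]

theorem gam_sz (t : CTree) : t.gam t.sz = 1 := by
  rw [← t.bet_one, gam_bet]

theorem eq_of_bet (s t : CTree) (hL : s.leaves = t.leaves)
    (h : ∀ x, 0 ≤ x → x ≤ 1 → s.bet x = t.bet x) : s = t := by
  induction s generalizing t with
  | leaf a =>
    cases t with
    | leaf b => simp [leaves] at hL; rw [hL]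
    | node l r =>
      have := congrArg List.length hL
      rw [length_leaves, length_leaves] at this
      have := l.sz_pos; have := r.sz_pos
      simp only [sz] at *; omega
  | node l r hl hr =>
    cases t with
    | leaf b =>
      have := congrArg List.length hL
      rw [length_leaves, length_leaves] at this
      have := l.sz_pos; have := r.sz_pos
      simp only [sz] at *; omega
    | node l' r' =>
      have hs : l.sz = l'.sz := by
        have := h (1/2) (by norm_num) (by norm_num)
        simp only [bet, le_refl, if_true] at this
        norm_num [bet_one] at this
        exact this
      simp only [leaves] at hL
      obtain ⟨h1, h2⟩ := List.append_inj hL (by rw [length_leaves, length_leaves, hs])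
      rw [hl l' h1, hr r' h2]
      · intro x h0 h1
        rcases h0.eq_or_lt with rfl | h0
        · rw [bet_zero, bet_zero]
        have := h ((x+1)/2) (by linarith) (by linarith)
        rw [bet, bet, if_neg (by linarith), if_neg (by linarith), hs,
          show 2 * ((x+1)/2) - 1 = x by ring] at this
        linarith
      · intro x h0 h1
        have := h (x/2) (by linarith) (by linarith)
        rw [bet, bet, if_pos (by linarith), if_pos (by linarith),
          show 2 * (x/2) = x by ring] at this
        exact this

theorem gam_affine (t : CTree) (i : ℕ) (hi : i < t.sz) :
    ∃ (k : ℤ) (c : ℝ), ∀ y : ℝ, i ≤ y → y ≤ i + 1 → t.gam y = 2 ^ k * y + c := by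
  induction t generalizing i with
  | leaf a => exact ⟨0, 0, fun y _ _ => by simp [gam]⟩
  | node l r hl hr =>
    by_cases h : i < l.sz
    · obtain ⟨k, c, H⟩ := hl i h
      refine ⟨k - 1, c / 2, fun y h1 h2 => ?_⟩
      have : (i:ℝ) + 1 ≤ l.sz := by exact_mod_cast h
      rw [gam, if_pos (by linarith), H y h1 h2, zpow_sub_one₀ (by norm_num)]
      ring
    · simp only [sz] at hi
      obtain ⟨k, c, H⟩ := hr (i - l.sz) (by omega)
      rw [Nat.cast_sub (by omega)] at H
      have hle : (l.sz:ℝ) ≤ i := by exact_mod_cast not_lt.1 h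
      refine ⟨k - 1, (c + 1) / 2 - 2 ^ (k-1) * l.sz, fun y h1 h2 => ?_⟩
      have e : (node l r).gam y = (r.gam (y - l.sz) + 1) / 2 := by
        rw [gam]
        split_ifs with h3
        · have : y = l.sz := by linarith
          rw [this, gam_sz, sub_self, gam_zero]; norm_num
        · rfl
      rw [e, H _ (by linarith) (by linarith), zpow_sub_one₀ (by norm_num)]
      ring

theorem gam_dyadic (t : CTree) (i : ℕ) (hi : i ≤ t.sz) :
    ∃ (a : ℤ) (b : ℕ), t.gam i = (a:ℝ) / 2 ^ b := by
  induction t generalizing i with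
  | leaf a => exact ⟨i, 0, by simp [gam]⟩
  | node l r hl hr =>
    by_cases h : i ≤ l.sz
    · obtain ⟨a, b, H⟩ := hl i h
      refine ⟨a, b + 1, ?_⟩
      rw [gam, if_pos (by exact_mod_cast h), H, pow_succ, div_div]
    · simp only [sz] at hi
      obtain ⟨a, b, H⟩ := hr (i - l.sz) (by omega)
      rw [Nat.cast_sub (by omega)] at H
      refine ⟨a + 2 ^ b, b + 1, ?_⟩
      rw [gam, if_neg (by exact_mod_cast h), H, pow_succ]
      push_cast
      field_simp

theorem gam_mem (s t : CTree) (h : s.sz = t.sz) (x : Set.Icc (0:ℝ) 1) :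
    t.gam (s.bet x) ∈ Set.Icc (0:ℝ) 1 := by
  constructor
  · rw [← t.bet_strictMono.le_iff_le, bet_gam, bet_zero]
    exact s.bet_zero.symm.le.trans (s.bet_strictMono.monotone x.2.1)
  · rw [← t.bet_strictMono.le_iff_le, bet_gam, bet_one, ← h, ← s.bet_one]
    exact s.bet_strictMono.monotone x.2.2

/-- The permutation of the unit interval determined by a pair of trees. -/
noncomputable def PQ (s t : CTree) (h : s.sz = t.sz) : Equiv.Perm (Set.Icc (0:ℝ) 1) where
  toFun x := ⟨t.gam (s.bet x), gam_mem s t h x⟩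
  invFun x := ⟨s.gam (t.bet x), gam_mem t s h.symm x⟩
  left_inv x := by ext; simp [bet_gam, gam_bet]
  right_inv x := by ext; simp [bet_gam, gam_bet]

theorem PQ_thompson (s t : CTree) (h : s.sz = t.sz) : IsThompsonF (PQ s t h) := by
  refine ⟨?_, s.sz, fun i => s.gam (i : ℕ), ?_, ?_, ?_, ?_, ?_⟩
  · intro x y hxy
    exact t.gam_strictMono (s.bet_strictMono hxy)
  · simp [gam_zero]
  · simp [gam_sz]
  · intro i j hij
    exact s.gam_strictMono (by exact_mod_cast hij)
  · intro i
    exact s.gam_dyadic i (by omega)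
  · intro i
    obtain ⟨k, c, H⟩ := s.gam_affine i i.2
    obtain ⟨k', c', H'⟩ := t.gam_affine i (h ▸ i.2)
    refine ⟨k' - k, c' - 2 ^ (k' - k) * c, fun x h1 h2 => ?_⟩
    show t.gam (s.bet x) = _
    have h1' : (i:ℝ) ≤ s.bet x := by
      have := s.bet_strictMono.monotone h1
      simpa [bet_gam] using this
    have h2' : s.bet x ≤ (i:ℝ) + 1 := by
      have := s.bet_strictMono.monotone h2
      simpa [bet_gam] using this
    have e := H _ h1' h2'
    rw [gam_bet] at e
    rw [H' _ h1' h2', zpow_sub₀ (by norm_num)]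
    generalize s.bet x = y at *
    rw [e]
    have : (2:ℝ) ^ k ≠ 0 := by positivity
    field_simp
    ring

/-- Depth of the largest complete tree contained in a tree. -/
def fd : CTree → ℕ
  | leaf _ => 0
  | node l r => min (fd l) (fd r) + 1

/-- Complete tree. -/
def full : ℕ → CTree
  | 0 => leaf 1
  | n+1 => node (full n) (full n)

theorem fd_full (n : ℕ) : (full n).fd = n := by
  induction n with
  | zero => rfl
  | succ n ih => simp [full, fd, ih]

theorem sz_full (n : ℕ) : (full n).sz = 2 ^ n := by
  induction n with
  | zero => rfl
  | succ n ih => simp [full, sz, ih]; ring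

theorem leaves_full (n : ℕ) : (full n).leaves = List.replicate (2 ^ n) 1 := by
  induction n with
  | zero => rfl
  | succ n ih => simp [full, leaves, ih]; ring_nf

theorem gam_full (n : ℕ) (y : ℝ) : (full n).gam y = y / 2 ^ n := by
  induction n generalizing y with
  | zero => simp [full, gam]
  | succ n ih =>
    simp only [full, gam, ih, sz_full]
    push_cast
    split_ifs
    · rw [pow_succ]; field_simp
    · rw [pow_succ]; field_simp; ring

end CTree

open CTree

theorem applyAt_cons (b : Bool) (α : Addr) (f : PMap) :
    applyAt (b :: α) f = applyAt [b] (applyAt α f) := by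
  cases b <;> rfl

/-- `f` acts on trees through a fixed piecewise linear map. -/
def ResP (f : PMap) : Prop := ∃ h : ℝ → ℝ, ∀ t t', f t = some t' →
  t.leaves = t'.leaves ∧ ∀ x, t'.bet (h x) = t.bet x

theorem sz_of_leaves {s t : CTree} (h : s.leaves = t.leaves) : s.sz = t.sz := by
  rw [← length_leaves, ← length_leaves, h]

theorem resP_A : ResP opA := by
  refine ⟨fun x => if x ≤ 1/2 then x/2 else if x ≤ 3/4 then x - 1/4 else 2*x-1, ?_⟩
  intro t t' h
  match t, h with
  | .node t₁ (.node t₂ t₃), h =>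
    simp only [opA, Option.some.injEq] at h
    subst h
    refine ⟨by simp [leaves], fun x => ?_⟩
    simp only [bet, sz]
    split_ifs <;> first | (exfalso; linarith) | (push_cast; ring_nf)

theorem resP_Ai : ResP opAi := by
  refine ⟨fun x => if x ≤ 1/4 then 2*x else if x ≤ 1/2 then x + 1/4 else (x+1)/2, ?_⟩
  intro t t' h
  match t, h with
  | .node (.node t₁ t₂) t₃, h =>
    simp only [opAi, Option.some.injEq] at h
    subst h
    refine ⟨by simp [leaves], fun x => ?_⟩
    simp only [bet, sz]
    split_ifs <;> first | (exfalso; linarith) | (push_cast; ring_nf)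

theorem applyAt_false {f : PMap} {t t' : CTree} (h : applyAt [false] f t = some t') :
    ∃ l l' r, t = node l r ∧ t' = node l' r ∧ f l = some l' := by
  cases t with
  | leaf a => simp [applyAt] at h
  | node l r =>
    simp only [applyAt, Option.map_eq_some_iff] at h
    obtain ⟨l', h, rfl⟩ := h
    exact ⟨l, l', r, rfl, rfl, h⟩

theorem applyAt_true {f : PMap} {t t' : CTree} (h : applyAt [true] f t = some t') :
    ∃ l r r', t = node l r ∧ t' = node l r' ∧ f r = some r' := by
  cases t with
  | leaf a => simp [applyAt] at h
  | node l r =>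
    simp only [applyAt, Option.map_eq_some_iff] at h
    obtain ⟨l', h, rfl⟩ := h
    exact ⟨l, r, l', rfl, rfl, h⟩

theorem resP_false {f : PMap} (hf : ResP f) : ResP (applyAt [false] f) := by
  obtain ⟨h, H⟩ := hf
  refine ⟨fun x => if x ≤ 1/2 then h (2*x) / 2 else x, fun t t' e => ?_⟩
  obtain ⟨l, l', r, rfl, rfl, e'⟩ := applyAt_false e
  obtain ⟨h1, h2⟩ := H _ _ e'
  refine ⟨by simp [leaves, h1], fun x => ?_⟩
  by_cases hx : x ≤ 1/2
  · have : h (2*x) ≤ 1 := by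
      rw [← l'.bet_strictMono.le_iff_le, h2, bet_one, ← sz_of_leaves h1, ← bet_one]
      exact l.bet_strictMono.monotone (by linarith)
    simp only [if_pos hx]
    rw [bet, bet, if_pos hx, if_pos (by linarith), ← h2]
    ring_nf
  · simp only [if_neg hx]
    rw [bet, bet, if_neg hx, if_neg hx, sz_of_leaves h1]

theorem resP_true {f : PMap} (hf : ResP f) : ResP (applyAt [true] f) := by
  obtain ⟨h, H⟩ := hf
  refine ⟨fun x => if x ≤ 1/2 then x else (h (2*x-1) + 1) / 2, fun t t' e => ?_⟩
  obtain ⟨l, r, r', rfl, rfl, e'⟩ := applyAt_true e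
  obtain ⟨h1, h2⟩ := H _ _ e'
  refine ⟨by simp [leaves, h1], fun x => ?_⟩
  by_cases hx : x ≤ 1/2
  · simp only [if_pos hx]
    rw [bet, bet, if_pos hx, if_pos hx]
  · have : 0 < h (2*x-1) := by
      rw [← r'.bet_strictMono.lt_iff_lt, h2, bet_zero, ← r.bet_zero]
      exact r.bet_strictMono (by linarith)
    simp only [if_neg hx]
    rw [bet, bet, if_neg hx, if_neg (by linarith), ← h2]
    ring_nf

theorem resP_applyAt {f : PMap} (hf : ResP f) (α : Addr) : ResP (applyAt α f) := by
  induction α with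
  | nil => exact hf
  | cons b α ih =>
    rw [applyAt_cons]
    cases b
    · exact resP_false ih
    · exact resP_true ih

theorem mul_some {f g : PMap} {t t' : CTree} (h : (f * g) t = some t') :
    ∃ u, f t = some u ∧ g u = some t' := Option.bind_eq_some_iff.1 h

theorem some_mul {f g : PMap} {t u t' : CTree} (h : f t = some u) (h' : g u = some t') :
    (f * g) t = some t' := Option.bind_eq_some_iff.2 ⟨u, h, h'⟩

theorem resP_geo {f : PMap} (hf : f ∈ GeoA) : ResP f := by
  induction hf using Submonoid.closure_induction with
  | mem f hf =>
    obtain ⟨α, rfl | rfl⟩ := hf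
    · exact resP_applyAt resP_A α
    · exact resP_applyAt resP_Ai α
  | one =>
    refine ⟨id, fun t t' h => ?_⟩
    have h : some t = some t' := h
    cases h
    exact ⟨rfl, fun x => rfl⟩
  | mul f g _ _ hf hg =>
    obtain ⟨h, H⟩ := hf
    obtain ⟨k, K⟩ := hg
    refine ⟨k ∘ h, fun t t' e => ?_⟩
    obtain ⟨u, e1, e2⟩ := mul_some e
    obtain ⟨a, b⟩ := H _ _ e1
    obtain ⟨c, d⟩ := K _ _ e2
    exact ⟨a.trans c, fun x => by simp [d, b]⟩

/-- `f` is defined on all sufficiently large trees. -/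
def Big (f : PMap) : Prop := ∃ N, ∀ t : CTree, N ≤ t.fd → ∃ t', f t = some t' ∧ t.fd ≤ t'.fd + N

theorem big_applyAt {f : PMap} (hf : Big f) (α : Addr) : Big (applyAt α f) := by
  induction α with
  | nil => exact hf
  | cons b α ih =>
    obtain ⟨N, H⟩ := ih
    rw [applyAt_cons]
    refine ⟨N + 1, fun t ht => ?_⟩
    cases t with
    | leaf a => simp [fd] at ht
    | node l r =>
      simp only [fd] at ht
      cases b
      · obtain ⟨l', e, h⟩ := H l (by omega)
        exact ⟨node l' r, by simp [applyAt, e], by simp only [fd]; omega⟩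
      · obtain ⟨l', e, h⟩ := H r (by omega)
        exact ⟨node l l', by simp [applyAt, e], by simp only [fd]; omega⟩

theorem big_A : Big opA := by
  refine ⟨2, fun t ht => ?_⟩
  match t, ht with
  | .node t₁ (.node t₂ t₃), ht =>
    exact ⟨_, rfl, by simp only [fd]; omega⟩
  | .leaf _, ht => simp [fd] at ht
  | .node _ (.leaf _), ht => simp [fd] at ht

theorem big_Ai : Big opAi := by
  refine ⟨2, fun t ht => ?_⟩
  match t, ht with
  | .node (.node t₁ t₂) t₃, ht =>
    exact ⟨_, rfl, by simp only [fd]; omega⟩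
  | .leaf _, ht => simp [fd] at ht
  | .node (.leaf _) _, ht => simp [fd] at ht

theorem big_geo {f : PMap} (hf : f ∈ GeoA) : Big f := by
  induction hf using Submonoid.closure_induction with
  | mem f hf =>
    obtain ⟨α, rfl | rfl⟩ := hf
    · exact big_applyAt big_A α
    · exact big_applyAt big_Ai α
  | one => exact ⟨0, fun t _ => ⟨t, rfl, by omega⟩⟩
  | mul f g _ _ hf hg =>
    obtain ⟨N, H⟩ := hf
    obtain ⟨M, K⟩ := hg
    refine ⟨N + M, fun t ht => ?_⟩
    obtain ⟨u, e, h⟩ := H t (by omega)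
    obtain ⟨v, e', h'⟩ := K u (by omega)
    exact ⟨v, some_mul e e', by omega⟩

theorem common_dom {f g : PMap} (hf : f ∈ GeoA) (hg : g ∈ GeoA) :
    ∃ t t' t'', f t = some t' ∧ g t = some t'' := by
  obtain ⟨N, H⟩ := big_geo hf
  obtain ⟨M, K⟩ := big_geo hg
  obtain ⟨u, e, _⟩ := H (full (N + M)) (by rw [fd_full]; omega)
  obtain ⟨v, ev, _⟩ := K (full (N + M)) (by rw [fd_full]; omega)
  exact ⟨_, u, v, e, ev⟩

/-- Some element of the geometry monoid maps `s` to `t`. -/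
def Conn (s t : CTree) : Prop := ∃ f ∈ GeoA, f s = some t

theorem Conn.rfl' (s : CTree) : Conn s s := ⟨1, one_mem _, rfl⟩

theorem Conn.trans' {s t u : CTree} : Conn s t → Conn t u → Conn s u := by
  rintro ⟨f, hf, e⟩ ⟨g, hg, e'⟩
  exact ⟨f * g, mul_mem hf hg, some_mul e e'⟩

theorem applyAt_inv {f g : PMap} (h : ∀ s t, f s = some t → g t = some s) (α : Addr) :
    ∀ s t, applyAt α f s = some t → applyAt α g t = some s := by
  induction α with
  | nil => exact h
  | cons b α ih =>
    intro s t e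
    rw [applyAt_cons] at e ⊢
    cases b
    · obtain ⟨l, l', r, rfl, rfl, e'⟩ := applyAt_false e
      simp [applyAt, ih _ _ e']
    · obtain ⟨l, l', r, rfl, rfl, e'⟩ := applyAt_true e
      simp [applyAt, ih _ _ e']

theorem opA_inv (s t : CTree) (h : opA s = some t) : opAi t = some s := by
  match s, h with
  | .node t₁ (.node t₂ t₃), h =>
    simp only [opA, Option.some.injEq] at h
    subst h; rfl

theorem opAi_inv (s t : CTree) (h : opAi s = some t) : opA t = some s := by
  match s, h with
  | .node (.node t₁ t₂) t₃, h =>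
    simp only [opAi, Option.some.injEq] at h
    subst h; rfl

theorem Conn.symm' {s t : CTree} : Conn s t → Conn t s := by
  rintro ⟨f, hf, e⟩
  induction hf using Submonoid.closure_induction generalizing s t with
  | mem f hf =>
    obtain ⟨α, rfl | rfl⟩ := hf
    · exact ⟨_, Submonoid.subset_closure ⟨α, Or.inr rfl⟩, applyAt_inv opA_inv α _ _ e⟩
    · exact ⟨_, Submonoid.subset_closure ⟨α, Or.inl rfl⟩, applyAt_inv opAi_inv α _ _ e⟩
  | one =>
    have h : some s = some t := e
    cases h
    exact Conn.rfl' _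
  | mul f g _ _ hf hg =>
    obtain ⟨u, e1, e2⟩ := mul_some e
    exact (hg e2).trans' (hf e1)

theorem genA_cons {f : PMap} (hf : f ∈ genA) (b : Bool) : applyAt [b] f ∈ genA := by
  obtain ⟨α, rfl | rfl⟩ := hf
  · exact ⟨b :: α, Or.inl (applyAt_cons _ _ _).symm⟩
  · exact ⟨b :: α, Or.inr (applyAt_cons _ _ _).symm⟩

theorem Conn.left {s t : CTree} (r : CTree) : Conn s t → Conn (node s r) (node t r) := by
  rintro ⟨f, hf, e⟩
  induction hf using Submonoid.closure_induction generalizing s t with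
  | mem f hf =>
    exact ⟨_, Submonoid.subset_closure (genA_cons hf false), by simp [applyAt, e]⟩
  | one =>
    have h : some s = some t := e
    cases h
    exact Conn.rfl' _
  | mul f g _ _ hf hg =>
    obtain ⟨u, e1, e2⟩ := mul_some e
    exact (hf e1).trans' (hg e2)

theorem Conn.right {s t : CTree} (l : CTree) : Conn s t → Conn (node l s) (node l t) := by
  rintro ⟨f, hf, e⟩
  induction hf using Submonoid.closure_induction generalizing s t with
  | mem f hf =>
    exact ⟨_, Submonoid.subset_closure (genA_cons hf true), by simp [applyAt, e]⟩
  | one =>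
    have h : some s = some t := e
    cases h
    exact Conn.rfl' _
  | mul f g _ _ hf hg =>
    obtain ⟨u, e1, e2⟩ := mul_some e
    exact (hf e1).trans' (hg e2)

theorem Conn.assoc (a b c : CTree) : Conn (node (node a b) c) (node a (node b c)) :=
  ⟨opAi, Submonoid.subset_closure ⟨[], Or.inr rfl⟩, rfl⟩

/-- Graft a list of leaves on the left of a tree. -/
def graft (L : List ℕ+) (u : CTree) : CTree := L.foldr (fun a v => node (leaf a) v) u

theorem conn_graft (t u : CTree) : Conn (node t u) (graft t.leaves u) := by
  induction t generalizing u with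
  | leaf a => exact Conn.rfl' _
  | node l r hl hr =>
    have : graft (node l r).leaves u = graft l.leaves (graft r.leaves u) := by
      simp [graft, leaves]
    rw [this]
    exact (Conn.assoc l r u).trans' (((hr u).right l).trans' (hl _))

/-- The right comb with given leaves. -/
def comb : List ℕ+ → CTree
  | [] => leaf 1
  | [a] => leaf a
  | a :: b :: L => node (leaf a) (comb (b :: L))

theorem comb_append (L M : List ℕ+) (hM : M ≠ []) : comb (L ++ M) = graft L (comb M) := by
  induction L with
  | nil => rfl
  | cons a L ih =>
    obtain ⟨b, K, hK⟩ : ∃ b K, L ++ M = b :: K := by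
      cases h : L ++ M with
      | nil => simp at h; exact absurd h.2 hM
      | cons b K => exact ⟨b, K, rfl⟩
    rw [List.cons_append, hK, comb, ← hK, ih]; rfl

theorem conn_comb (t : CTree) : Conn t (comb t.leaves) := by
  induction t with
  | leaf a => exact Conn.rfl' _
  | node l r hl hr =>
    rw [leaves, comb_append _ _ (by
      rw [← List.length_pos_iff, length_leaves]; exact r.sz_pos)]
    exact (hr.right l).trans' (conn_graft _ _)

theorem conn_of_leaves {s t : CTree} (h : s.leaves = t.leaves) : Conn s t :=
  (conn_comb s).trans' (h ▸ (conn_comb t).symm')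

theorem exists_tree (n : ℕ) (hn : 0 < n) (H : ℝ → ℝ)
    (mono : ∀ i j : ℕ, i < j → j ≤ n → H i < H j) (H0 : H 0 = 0) (Hn : H n = 1)
    (pc : ∀ i : ℕ, i < n → ∃ (m : ℕ) (a : ℤ), ∀ y : ℝ, i ≤ y → y ≤ i + 1 →
      H y = (y - i + a) / 2 ^ m) :
    ∃ t : CTree, t.leaves = List.replicate n 1 ∧
      ∀ y : ℝ, 0 ≤ y → y ≤ n → t.gam y = H y := by
  induction n using Nat.strong_induction_on generalizing H with
  | _ n ih =>
  have ends : ∀ i : ℕ, i < n → ∀ (m : ℕ) (a : ℤ), (∀ y : ℝ, i ≤ y → y ≤ i + 1 →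
      H y = (y - i + a) / 2 ^ m) → H i = a / 2 ^ m ∧ H (i + 1 : ℕ) = (a + 1) / 2 ^ m := by
    intro i _ m a h
    constructor
    · rw [h i le_rfl (by linarith)]; ring
    · push_cast; rw [h (i+1) (by linarith) le_rfl]; ring
  have mono' : ∀ i j : ℕ, i ≤ j → j ≤ n → H i ≤ H j := by
    intro i j h1 h2
    rcases h1.eq_or_lt with rfl | h1
    · exact le_rfl
    · exact (mono i j h1 h2).le
  by_cases h1 : n = 1
  · subst h1
    refine ⟨leaf 1, rfl, fun y h0 h1 => ?_⟩
    obtain ⟨m, a, h⟩ := pc 0 (by norm_num)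
    obtain ⟨e1, e2⟩ := ends 0 (by norm_num) m a h
    have hp : (2:ℝ) ^ m ≠ 0 := by positivity
    have ha : (a:ℝ) = 0 := by
      simp only [Nat.cast_zero, H0] at e1
      field_simp at e1; linarith
    have hm : (2:ℝ) ^ m = 1 := by
      rw [zero_add, Hn, ha] at e2
      field_simp at e2; linarith
    rw [h y (by simpa using h0) (by simpa using h1), ha, hm]
    simp [gam]
  · obtain ⟨j, hj0, hjn, hj⟩ : ∃ j : ℕ, 0 < j ∧ j < n ∧ H j = 1/2 := by
      classical
      have hex : ∃ k : ℕ, 1/2 < H k ∧ k ≤ n := ⟨n, by rw [Hn]; norm_num, le_rfl⟩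
      obtain ⟨hk1, hk2⟩ := Nat.find_spec hex
      have hmin := fun m => Nat.find_min (H := hex) (m := m)
      generalize Nat.find hex = k at *
      obtain _ | j := k
      · simp [H0] at hk1; norm_num at hk1
      have hj : H j ≤ 1/2 := by
        by_contra hc
        exact hmin j (by omega) ⟨not_le.1 hc, by omega⟩
      have key : H j = 1/2 := by
        by_contra hne
        have hlt := lt_of_le_of_ne hj hne
        obtain ⟨m, a, h⟩ := pc j (by omega)
        obtain ⟨e1, e2⟩ := ends j (by omega) m a h
        have hp : (0:ℝ) < 2 ^ m := by positivity
        rw [e1, div_lt_div_iff₀ hp (by norm_num)] at hlt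
        rw [e2, div_lt_div_iff₀ (by norm_num) hp] at hk1
        have i1 : a * 2 < 1 * 2 ^ m := by exact_mod_cast hlt
        have i2 : 1 * 2 ^ m < (a + 1) * 2 := by exact_mod_cast hk1
        obtain _ | m := m
        · have ha : a = 0 := by omega
          subst ha
          simp at e1 e2
          have hj0 : j = 0 := by
            by_contra hc
            have := mono 0 j (by omega) (by omega)
            rw [e1] at this
            simp [H0] at this
          have hjn : j + 1 = n := by
            by_contra hc
            have := mono (j+1) n (by omega) le_rfl
            rw [Hn] at this
            push_cast at this
            linarith
          omega
        · rw [pow_succ] at i1 i2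
          omega
      refine ⟨j, ?_, by omega, key⟩
      rcases Nat.eq_zero_or_pos j with rfl | h
      · simp [H0] at key
      · exact h
    obtain ⟨l, hl1, hl2⟩ := ih j hjn hj0 (fun y => 2 * H y)
      (fun i k h1 h2 => by have := mono i k h1 (by omega); linarith)
      (by simp [H0]) (by simp only [hj]; norm_num) (by
        intro i hi
        obtain ⟨m, a, h⟩ := pc i (by omega)
        obtain ⟨e1, e2⟩ := ends i (by omega) m a h
        have b1 := mono' (i+1) j (by omega) (by omega)
        have b2 := mono' 0 i (by omega) (by omega)
        rw [Nat.cast_zero, H0] at b2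
        rw [e2, hj] at b1
        rw [e1] at b2
        obtain _ | m := m
        · exfalso
          simp at b1 b2
          have : (0:ℝ) ≤ a := by exact_mod_cast b2
          norm_num at b1
          linarith
        · refine ⟨m, a, fun y h1 h2 => ?_⟩
          rw [h y h1 h2, pow_succ]; field_simp)
    obtain ⟨r, hr1, hr2⟩ := ih (n - j) (by omega) (by omega) (fun y => 2 * H (y + j) - 1)
      (fun i k h1 h2 => by
        have := mono (i + j) (k + j) (by omega) (by omega)
        push_cast at this
        linarith)
      (by simp [hj])
      (by simp only [Nat.cast_sub hjn.le, sub_add_cancel, Hn]; norm_num) (by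
        intro i hi
        obtain ⟨m, a, h⟩ := pc (i + j) (by omega)
        obtain ⟨e1, e2⟩ := ends (i + j) (by omega) m a h
        have b1 := mono' (i+j+1) n (by omega) (by omega)
        have b2 := mono' j (i+j) (by omega) (by omega)
        rw [hj, e1] at b2
        rw [e2, Hn] at b1
        obtain _ | m := m
        · exfalso
          simp at b1 b2
          have : (a:ℝ) ≤ 0 := by exact_mod_cast b1
          norm_num at b2
          linarith
        · refine ⟨m, a - 2 ^ m, fun y h1 h2 => ?_⟩
          rw [h (y + j) (by push_cast; linarith) (by push_cast; linarith), pow_succ]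
          push_cast
          field_simp
          ring)
    have hsz : l.sz = j := by rw [← length_leaves, hl1, List.length_replicate]
    refine ⟨node l r, ?_, fun y h0 h1 => ?_⟩
    · rw [leaves, hl1, hr1, List.replicate_append_replicate]
      congr 1; omega
    · rw [gam, hsz]
      split_ifs with h
      · rw [hl2 y h0 h]; ring
      · rw [Nat.cast_sub hjn.le] at hr2
        rw [hr2 (y - j) (by linarith) (by linarith)]
        ring_nf

theorem find_piece (n : ℕ) (x : Fin (n+1) → ℝ) (u : ℝ) (h0 : x 0 ≤ u) (h1 : u < x (Fin.last n)) :
    ∃ j : Fin n, x j.castSucc ≤ u ∧ u < x j.succ := by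
  by_contra! hc
  have : ∀ i, x i ≤ u := by
    intro i
    induction i using Fin.induction with
    | zero => exact h0
    | succ i ih => exact hc i ih
  exact absurd (this (Fin.last n)) (not_le.2 h1)

/-- Dyadic rationals. -/
def Dy (x : ℝ) : Prop := ∃ (a : ℤ) (b : ℕ), x = (a : ℝ) / 2 ^ b

theorem Dy.add {x y : ℝ} : Dy x → Dy y → Dy (x + y) := by
  rintro ⟨a, b, rfl⟩ ⟨c, d, rfl⟩
  refine ⟨a * 2 ^ d + c * 2 ^ b, b + d, ?_⟩
  push_cast
  rw [pow_add]
  field_simp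

theorem Dy.neg {x : ℝ} : Dy x → Dy (-x) := by
  rintro ⟨a, b, rfl⟩
  exact ⟨-a, b, by push_cast; ring⟩

theorem Dy.zpow_mul {x : ℝ} (k : ℤ) : Dy x → Dy (2 ^ k * x) := by
  rintro ⟨a, b, rfl⟩
  obtain ⟨n, rfl | rfl⟩ := Int.eq_nat_or_neg k
  · exact ⟨2 ^ n * a, b, by push_cast; rw [zpow_natCast]; ring⟩
  · refine ⟨a, b + n, ?_⟩
    rw [zpow_neg, zpow_natCast, pow_add]; field_simp

theorem Dy.eventually {x : ℝ} (k : ℤ) (h : Dy x) :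
    ∀ᶠ N : ℕ in Filter.atTop, k ≤ N ∧ ∃ a : ℤ, x * 2 ^ ((N:ℤ) - k) = a := by
  obtain ⟨a, b, rfl⟩ := h
  filter_upwards [Filter.eventually_ge_atTop (k.toNat + b)] with N hN
  have hk : k ≤ k.toNat := Int.self_le_toNat k
  refine ⟨by omega, ?_⟩
  obtain ⟨m, hm⟩ : ∃ m : ℕ, (N:ℤ) - k = b + m := ⟨((N:ℤ) - k - b).toNat, by omega⟩
  refine ⟨a * 2 ^ m, ?_⟩
  rw [hm, zpow_add₀ (by norm_num), zpow_natCast, zpow_natCast]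
  push_cast
  field_simp

theorem exists_PQ (f : Equiv.Perm (Set.Icc (0:ℝ) 1)) (hf : IsThompsonF f) :
    ∃ s t : CTree, s.leaves = t.leaves ∧ ∀ x : Set.Icc (0:ℝ) 1, (f x : ℝ) = t.gam (s.bet x) := by
  obtain ⟨fmono, n, x, x0, x1, xm, xd, hp⟩ := hf
  choose k c hkc using hp
  have f0 : (f ⟨0, by norm_num⟩ : ℝ) = 0 := by
    obtain ⟨z, hz⟩ := f.surjective ⟨0, by norm_num⟩
    have h1 : f ⟨0, by norm_num⟩ ≤ f z := fmono.monotone (show (0:ℝ) ≤ z from z.2.1)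
    rw [hz] at h1
    exact le_antisymm h1 (f _).2.1
  have f1 : (f ⟨1, by norm_num⟩ : ℝ) = 1 := by
    obtain ⟨z, hz⟩ := f.surjective ⟨1, by norm_num⟩
    have h1 : f z ≤ f ⟨1, by norm_num⟩ := fmono.monotone (show (z:ℝ) ≤ 1 from z.2.2)
    rw [hz] at h1
    exact le_antisymm (f _).2.2 h1
  have xI : ∀ i, x i ∈ Set.Icc (0:ℝ) 1 := fun i =>
    ⟨x0 ▸ xm.monotone (Fin.zero_le i), x1 ▸ xm.monotone (Fin.le_last i)⟩
  have fd : ∀ i, Dy (f ⟨x i, xI i⟩) := by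
    intro i
    induction i using Fin.induction with
    | zero => simp only [x0]; exact ⟨0, 0, by rw [f0]; simp⟩
    | succ i ih =>
      have hlt : x i.castSucc ≤ x i.succ := (xm (Fin.castSucc_lt_succ)).le
      have e1 := hkc i ⟨_, xI i.castSucc⟩ le_rfl hlt
      have e2 := hkc i ⟨_, xI i.succ⟩ hlt le_rfl
      have : (f ⟨x i.succ, xI i.succ⟩ : ℝ) = f ⟨x i.castSucc, xI i.castSucc⟩ +
        2 ^ (k i) * (x i.succ + - x i.castSucc) := by
        rw [e1, e2]; ring
      rw [this]
      exact ih.add (Dy.zpow_mul _ (Dy.add (xd _) (Dy.neg (xd _))))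
  have cd : ∀ i, Dy (c i) := by
    intro i
    have hlt : x i.castSucc ≤ x i.succ := (xm (Fin.castSucc_lt_succ)).le
    have e1 := hkc i ⟨_, xI i.castSucc⟩ le_rfl hlt
    have : c i = f ⟨x i.castSucc, xI i.castSucc⟩ + - (2 ^ (k i) * x i.castSucc) := by
      rw [e1]; ring
    rw [this]
    exact (fd _).add (Dy.neg (Dy.zpow_mul _ (xd _)))
  obtain ⟨N, hN1, hN2⟩ := ((Filter.eventually_all.2 fun i => Dy.eventually (k i) (cd i)).and
    (Filter.eventually_all.2 fun i => Dy.eventually 0 (xd i))).exists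
  have hpN : (0:ℝ) < 2 ^ N := by positivity
  let H : ℝ → ℝ := fun y => Set.IccExtend (zero_le_one (α := ℝ)) (fun z => (f z : ℝ)) (y / 2 ^ N)
  have HH : ∀ (y : ℝ) (hy : y / 2 ^ N ∈ Set.Icc (0:ℝ) 1), H y = f ⟨y / 2 ^ N, hy⟩ :=
    fun y hy => Set.IccExtend_of_mem _ _ hy
  have mem : ∀ y : ℝ, 0 ≤ y → y ≤ 2 ^ N → y / 2 ^ N ∈ Set.Icc (0:ℝ) 1 := fun y h0 h1 =>
    ⟨by positivity, (div_le_one hpN).2 h1⟩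
  obtain ⟨t, ht1, ht2⟩ := exists_tree (2 ^ N) (by positivity) H (by
      intro i j hij hj
      have hj' : (j:ℝ) ≤ 2 ^ N := by exact_mod_cast hj
      have hij' : (i:ℝ) < j := by exact_mod_cast hij
      rw [HH i (mem _ (by positivity) (by linarith)), HH j (mem _ (by positivity) hj')]
      exact fmono (show (i:ℝ) / 2 ^ N < j / 2 ^ N by gcongr)) (by
      rw [HH 0 (mem _ le_rfl hpN.le)]
      simp only [zero_div]; exact f0) (by
      rw [HH _ (mem _ (by positivity) (by push_cast; exact le_rfl))]
      simp only [Nat.cast_pow, Nat.cast_ofNat, div_self hpN.ne']; exact f1) (by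
      intro i hi
      have hi' : (i:ℝ) + 1 ≤ 2 ^ N := by exact_mod_cast hi
      obtain ⟨j, hj1, hj2⟩ := find_piece n x (i / 2 ^ N) (by rw [x0]; positivity)
        (by rw [x1, div_lt_one hpN]; linarith)
      obtain ⟨hk, a, ha⟩ := hN1 j
      obtain ⟨_, b, hb⟩ := hN2 j.succ
      rw [sub_zero, zpow_natCast] at hb
      have hj3 : ((i:ℝ) + 1) / 2 ^ N ≤ x j.succ := by
        rw [div_lt_iff₀ hpN, hb] at hj2
        rw [div_le_iff₀ hpN, hb]
        have : (i:ℤ) < b := by exact_mod_cast hj2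
        exact_mod_cast this
      obtain ⟨m, hm⟩ : ∃ m : ℕ, (N:ℤ) - k j = m := ⟨((N:ℤ) - k j).toNat, by omega⟩
      refine ⟨m, i + a, fun y h1 h2 => ?_⟩
      have i0 : (0:ℝ) ≤ i := by positivity
      rw [HH y (mem y (by linarith) (by linarith)), hkc j _
        (hj1.trans (show (i:ℝ) / 2 ^ N ≤ y / 2 ^ N by gcongr))
        (le_trans (show y / 2 ^ N ≤ ((i:ℝ) + 1) / 2 ^ N by gcongr) hj3)]
      have hkj : k j = N - m := by omega
      rw [hm, zpow_natCast] at ha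
      push_cast
      rw [← ha, hkj, zpow_sub₀ (by norm_num), zpow_natCast, zpow_natCast]
      field_simp
      ring)
  refine ⟨full N, t, by rw [ht1, leaves_full], fun z => ?_⟩
  have hz : (full N).bet z / 2 ^ N = z := by rw [← gam_full, gam_bet]
  have hz' : (full N).bet z = z * 2 ^ N := by field_simp at hz; linarith
  have z0 := z.2.1
  have z1 := z.2.2
  rw [hz', ht2 _ (by positivity) (by push_cast; nlinarith)]
  have e : (z:ℝ) * 2 ^ N / 2 ^ N = z := by field_simp
  rw [HH _ (by rw [e]; exact z.2)]
  simp only [e]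

/-- Proposition 2.6: the geometry group `G(A)` of associativity — i.e. any group
`G` obtained from the geometry monoid `𝒢(A)` by identifying near-equal elements —
is isomorphic to Thompson's group `F`. -/
theorem stmt5 (G : Type*) [Group G] (q : GeoA →* G)
    (hsurj : Function.Surjective q)
    (hiff : ∀ f g : GeoA, q f = q g ↔ NearEq f.1 g.1) :
    ∃ φ : G → Equiv.Perm (Set.Icc (0:ℝ) 1),
      Function.Injective φ ∧ (∀ g h : G, φ (g * h) = φ g * φ h) ∧
      Set.range φ = {f | IsThompsonF f} := by
  
  have key : ∀ g : G, ∃ p : Equiv.Perm (Set.Icc (0:ℝ) 1), IsThompsonF p ∧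
      ∀ f : GeoA, q f = g → ∀ t t', f.1 t = some t' →
        ∀ x : Set.Icc (0:ℝ) 1, (p x : ℝ) = t.gam (t'.bet x) := by
    intro g
    obtain ⟨f₀, rfl⟩ := hsurj g
    obtain ⟨s, s', _, es, _⟩ := common_dom f₀.2 f₀.2
    obtain ⟨h₀, H₀⟩ := resP_geo f₀.2
    refine ⟨PQ s' s (sz_of_leaves (H₀ _ _ es).1).symm, PQ_thompson _ _ _, ?_⟩
    intro f hf t t' e x
    obtain ⟨h, H⟩ := resP_geo f.2
    obtain ⟨u, v, w, e1, e2⟩ := common_dom f.2 f₀.2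
    have hvw : v = w := by
      have := ((hiff f f₀).1 hf).2 u (by rw [e1]; rfl) (by rw [e2]; rfl)
      rw [e1, e2] at this
      exact Option.some.inj this
    subst hvw
    have hh : ∀ y, h y = h₀ y := fun y => v.bet_strictMono.injective
      (by rw [(H _ _ e1).2, (H₀ _ _ e2).2])
    show s.gam (s'.bet x) = t.gam (t'.bet x)
    have a1 := (H _ _ e).2 (t.gam (t'.bet x))
    rw [bet_gam] at a1
    have a2 := (H₀ _ _ es).2 (s.gam (s'.bet x))
    rw [bet_gam] at a2
    have b1 := t'.bet_strictMono.injective a1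
    have b2 := s'.bet_strictMono.injective a2
    rw [hh] at b1
    have : v.bet (h₀ (t.gam (t'.bet x))) = v.bet (h₀ (s.gam (s'.bet x))) := by rw [b1, b2]
    rw [(H₀ _ _ e2).2, (H₀ _ _ e2).2] at this
    exact (u.bet_strictMono.injective this).symm
  choose φ hφT hφ using key
  refine ⟨φ, ?_, ?_, ?_⟩
  · intro g g' hgg
    obtain ⟨f, rfl⟩ := hsurj g
    obtain ⟨f', rfl⟩ := hsurj g'
    rw [hiff]
    obtain ⟨t, a, b, e1, e2⟩ := common_dom f.2 f'.2
    refine ⟨⟨t, by rw [e1]; rfl, by rw [e2]; rfl⟩, ?_⟩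
    intro t h1 h2
    obtain ⟨a, e1⟩ := Option.isSome_iff_exists.1 h1
    obtain ⟨b, e2⟩ := Option.isSome_iff_exists.1 h2
    rw [e1, e2]
    congr 1
    obtain ⟨h, H⟩ := resP_geo f.2
    obtain ⟨h', H'⟩ := resP_geo f'.2
    refine eq_of_bet a b ((H _ _ e1).1.symm.trans (H' _ _ e2).1) fun x x0 x1 => ?_
    have c1 := hφ _ f rfl _ _ e1 ⟨x, x0, x1⟩
    have c2 := hφ _ f' rfl _ _ e2 ⟨x, x0, x1⟩
    rw [hgg, c2] at c1
    exact (t.gam_strictMono.injective c1).symm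
  · intro g g'
    obtain ⟨f, rfl⟩ := hsurj g
    obtain ⟨f', rfl⟩ := hsurj g'
    obtain ⟨t, t', _, e, _⟩ := common_dom (f * f').2 (f * f').2
    obtain ⟨u, e1, e2⟩ := mul_some (f := f.1) (g := f'.1) e
    ext x
    rw [Equiv.Perm.mul_apply, hφ _ f rfl _ _ e1, hφ _ f' rfl _ _ e2,
      hφ _ (f * f') (map_mul q f f') _ _ e, bet_gam]
  · ext p
    constructor
    · rintro ⟨g, rfl⟩
      exact hφT g
    · intro hp
      obtain ⟨s, t, hst, hp'⟩ := exists_PQ p hp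
      obtain ⟨f, hf, e⟩ := conn_of_leaves hst.symm
      refine ⟨q ⟨f, hf⟩, ?_⟩
      ext x
      rw [hp', hφ _ ⟨f, hf⟩ rfl _ _ e]
end

section
/- For every address α, the pentagon relation A_α · A_α = A_{α1} · A_α · A_{α0} holds in the geometry monoid 𝒢(A): the composite partial map 'A_α then A_α' equals the composite 'A_{α1} then A_α then A_{α0}' (they have the same domain and agree on it). In particular, both composites map each tree whose α-subtree has the form t₁·(t₂·(t₃·t₄)) to the tree obtained by replacing that subtree with ((t₁·t₂)·t₃)·t₄. -/
/-- The `α`-subtree of a tree, when it exists. -/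
def subtreeAt : Addr → CTree → Option CTree
  | [], t => some t
  | _ :: _, .leaf _ => none
  | b :: α, .node t₁ t₂ => subtreeAt α (cond b t₂ t₁)

/-- Replace the `α`-subtree of a tree by `s`, when that subtree exists. -/
def replaceAt : Addr → CTree → CTree → Option CTree
  | [], s, _ => some s
  | _ :: _, _, .leaf _ => none
  | false :: α, s, .node t₁ t₂ => (replaceAt α s t₁).map (fun u => .node u t₂)
  | true :: α, s, .node t₁ t₂ => (replaceAt α s t₂).map (fun u => .node t₁ u)

theorem pmap_mul_apply (f g : PMap) (t : CTree) : (f * g) t = (f t).bind g := rfl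

theorem applyAt_append (α β : Addr) (f : PMap) :
    applyAt (α ++ β) f = applyAt α (applyAt β f) := by
  induction α with
  | nil => rfl
  | cons b α ih =>
    funext t
    cases b <;> cases t <;> simp [applyAt, ih]

theorem applyAt_mul (α : Addr) (f g : PMap) :
    applyAt α f * applyAt α g = applyAt α (f * g) := by
  induction α with
  | nil => rfl
  | cons b α ih =>
    funext t
    cases b with
    | false =>
      cases t with
      | leaf n => rfl
      | node a c =>
        simp only [pmap_mul_apply, applyAt, ← ih]
        cases applyAt α f a <;> rfl
    | true =>
      cases t with
      | leaf n => rfl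
      | node a c =>
        simp only [pmap_mul_apply, applyAt, ← ih]
        cases applyAt α f c <;> rfl

theorem pentagon_root :
    opA * opA = applyAt [true] opA * opA * applyAt [false] opA := by
  funext t
  rcases t with _ | ⟨a, _ | ⟨b, _ | ⟨c, d⟩⟩⟩ <;> rfl

theorem pentagon_at (α : Addr) :
    applyAt α opA * applyAt α opA =
      applyAt (α ++ [true]) opA * applyAt α opA * applyAt (α ++ [false]) opA := by
  rw [applyAt_append, applyAt_append, applyAt_mul, applyAt_mul, applyAt_mul, pentagon_root]

theorem applyAt_of_subtreeAt (f : PMap) (s u : CTree) (hf : f s = some u) (α : Addr) :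
    ∀ t, subtreeAt α t = some s → applyAt α f t = replaceAt α u t := by
  induction α with
  | nil =>
    intro t h
    simp only [subtreeAt, Option.some.injEq] at h
    subst h
    exact hf
  | cons b α ih =>
    intro t h
    cases t with
    | leaf n => simp [subtreeAt] at h
    | node a c =>
      cases b with
      | false => simp only [applyAt, replaceAt]; rw [ih a h]
      | true => simp only [applyAt, replaceAt]; rw [ih c h]

/-- Lemma 2.7, the pentagon relation: for each address `α`, the composite partial
map `A_α` then `A_α` is equal (same domain, same values) to the composite
`A_{α1}` then `A_α` then `A_{α0}`; in particular both send any tree whose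
`α`-subtree is `t₁·(t₂·(t₃·t₄))` to the tree obtained by replacing that subtree
with `((t₁·t₂)·t₃)·t₄`. -/
theorem stmt6 :
    (∀ α : Addr,
      applyAt α opA * applyAt α opA =
        applyAt (α ++ [true]) opA * applyAt α opA * applyAt (α ++ [false]) opA) ∧
    (∀ (α : Addr) (t t₁ t₂ t₃ t₄ : CTree),
      subtreeAt α t = some (.node t₁ (.node t₂ (.node t₃ t₄))) →
        (applyAt α opA * applyAt α opA) t =
          replaceAt α (.node (.node (.node t₁ t₂) t₃) t₄) t ∧
        (applyAt (α ++ [true]) opA * applyAt α opA * applyAt (α ++ [false]) opA) t =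
          replaceAt α (.node (.node (.node t₁ t₂) t₃) t₄) t) := by
  refine ⟨pentagon_at, fun α t t₁ t₂ t₃ t₄ h => ?_⟩
  rw [← pentagon_at, and_self, applyAt_mul]
  exact applyAt_of_subtreeAt (opA * opA) _ _ (by rfl) α t h
end

section
/- The relations R_AC (the A-geometric and C-geometric relations, the pentagon relations, and the hexagon relations) completed with the torsion relations C_α² = 1 make a presentation of the geometry group G(A,C) (isomorphic to Thompson's group V) in terms of the generators A_α and C_α: the canonical homomorphism from the group presented by generators {A_α, C_α : α an address} and these relations to G(A,C) is an isomorphism. -/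
/-- The generators of the geometry monoid `𝒢(A,C)`: the operators `A_α`, `C_α`
and their inverse partial maps (`C_α` is its own inverse). -/
def genAC : Set PMap :=
  {f | ∃ α : Addr, f = applyAt α opA ∨ f = applyAt α opAi ∨ f = applyAt α opC}

/-- The geometry monoid `𝒢(A,C)` of associativity and commutativity. -/
def GeoAC : Submonoid PMap := Submonoid.closure genAC

theorem memA (α : Addr) : applyAt α opA ∈ GeoAC :=
  Submonoid.subset_closure ⟨α, Or.inl rfl⟩

theorem memC (α : Addr) : applyAt α opC ∈ GeoAC :=
  Submonoid.subset_closure ⟨α, Or.inr (Or.inr rfl)⟩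

/-- Formal generators `A_α`, `C_α`. -/
inductive GenAC : Type
  | A : Addr → GenAC
  | C : Addr → GenAC

/-- `fX b α` is `A_α` for `b = false` and `C_α` for `b = true`, in the free group. -/
def fX : Bool → Addr → FreeGroup GenAC
  | false, α => FreeGroup.of (GenAC.A α)
  | true, α => FreeGroup.of (GenAC.C α)

/-- Abbreviations in the free group. -/
def fA (α : Addr) : FreeGroup GenAC := FreeGroup.of (GenAC.A α)
def fC (α : Addr) : FreeGroup GenAC := FreeGroup.of (GenAC.C α)

/-- The relations `R_AC` together with the torsion relations `C_α² = 1`, as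
relators: for `X, Y` ranging over `{A, C}` and all addresses `α, β, γ`:
`X_{γ0α}·Y_{γ1β} = Y_{γ1β}·X_{γ0α}`; `X_{γ11α}·A_γ = A_γ·X_{γ1α}`,
`X_{γ10α}·A_γ = A_γ·X_{γ01α}`, `X_{γ0α}·A_γ = A_γ·X_{γ00α}`;
`X_{γ0α}·C_γ = C_γ·X_{γ1α}`, `X_{γ1α}·C_γ = C_γ·X_{γ0α}`; the pentagon relations
`A_γ·A_γ = A_{γ1}·A_γ·A_{γ0}`; the hexagon relations
`A_γ·C_γ·A_γ = C_{γ1}·A_γ·C_{γ0}` and `A_γ⁻¹·C_γ·A_γ⁻¹ = C_{γ0}·A_γ⁻¹·C_{γ1}`;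
and `C_γ·C_γ = 1`. -/
def relsAC : Set (FreeGroup GenAC) :=
  {x | ∃ γ : Addr,
    (∃ (b b' : Bool) (α β : Addr),
      x = fX b (γ ++ false :: α) * fX b' (γ ++ true :: β) *
          (fX b' (γ ++ true :: β) * fX b (γ ++ false :: α))⁻¹) ∨
    (∃ (b : Bool) (α : Addr),
      x = fX b (γ ++ true :: true :: α) * fA γ * (fA γ * fX b (γ ++ true :: α))⁻¹) ∨
    (∃ (b : Bool) (α : Addr),
      x = fX b (γ ++ true :: false :: α) * fA γ *
          (fA γ * fX b (γ ++ false :: true :: α))⁻¹) ∨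
    (∃ (b : Bool) (α : Addr),
      x = fX b (γ ++ false :: α) * fA γ * (fA γ * fX b (γ ++ false :: false :: α))⁻¹) ∨
    (∃ (b : Bool) (α : Addr),
      x = fX b (γ ++ false :: α) * fC γ * (fC γ * fX b (γ ++ true :: α))⁻¹) ∨
    (∃ (b : Bool) (α : Addr),
      x = fX b (γ ++ true :: α) * fC γ * (fC γ * fX b (γ ++ false :: α))⁻¹) ∨
    (x = fA γ * fA γ * (fA (γ ++ [true]) * fA γ * fA (γ ++ [false]))⁻¹) ∨
    (x = fA γ * fC γ * fA γ * (fC (γ ++ [true]) * fA γ * fC (γ ++ [false]))⁻¹) ∨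
    (x = (fA γ)⁻¹ * fC γ * (fA γ)⁻¹ * (fC (γ ++ [false]) * (fA γ)⁻¹ * fC (γ ++ [true]))⁻¹) ∨
    (x = fC γ * fC γ)}

namespace ACProof

/-! ### The presented group -/

abbrev P := PresentedGroup relsAC

def pX : Bool → Addr → P
  | false, α => PresentedGroup.of (GenAC.A α)
  | true, α => PresentedGroup.of (GenAC.C α)

abbrev pA (α : Addr) : P := pX false α
abbrev pC (α : Addr) : P := pX true α

theorem mk_fX (b : Bool) (α : Addr) : PresentedGroup.mk relsAC (fX b α) = pX b α := by
  cases b <;> rfl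

theorem mk_fA (α : Addr) : PresentedGroup.mk relsAC (fA α) = pA α := rfl
theorem mk_fC (α : Addr) : PresentedGroup.mk relsAC (fC α) = pC α := rfl

theorem mk_rel {x y : FreeGroup GenAC} (h : x * y⁻¹ ∈ relsAC) :
    PresentedGroup.mk relsAC x = PresentedGroup.mk relsAC y := by
  have h1 := PresentedGroup.one_of_mem h
  rw [map_mul, map_inv] at h1
  exact mul_inv_eq_one.mp h1

theorem rel_comm (γ : Addr) (b b' : Bool) (α β : Addr) :
    pX b (γ ++ false :: α) * pX b' (γ ++ true :: β) =
      pX b' (γ ++ true :: β) * pX b (γ ++ false :: α) := by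
  have h := mk_rel (x := fX b (γ ++ false :: α) * fX b' (γ ++ true :: β))
    (y := fX b' (γ ++ true :: β) * fX b (γ ++ false :: α))
    ⟨γ, Or.inl ⟨b, b', α, β, rfl⟩⟩
  simpa only [map_mul, mk_fX] using h

theorem rel_A11 (γ : Addr) (b : Bool) (α : Addr) :
    pX b (γ ++ true :: true :: α) * pA γ = pA γ * pX b (γ ++ true :: α) := by
  have h := mk_rel (x := fX b (γ ++ true :: true :: α) * fA γ)
    (y := fA γ * fX b (γ ++ true :: α)) ⟨γ, Or.inr <| Or.inl ⟨b, α, rfl⟩⟩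
  simpa only [map_mul, mk_fX, mk_fA] using h

theorem rel_A10 (γ : Addr) (b : Bool) (α : Addr) :
    pX b (γ ++ true :: false :: α) * pA γ = pA γ * pX b (γ ++ false :: true :: α) := by
  have h := mk_rel (x := fX b (γ ++ true :: false :: α) * fA γ)
    (y := fA γ * fX b (γ ++ false :: true :: α)) ⟨γ, Or.inr <| Or.inr <| Or.inl ⟨b, α, rfl⟩⟩
  simpa only [map_mul, mk_fX, mk_fA] using h

theorem rel_A0 (γ : Addr) (b : Bool) (α : Addr) :
    pX b (γ ++ false :: α) * pA γ = pA γ * pX b (γ ++ false :: false :: α) := by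
  have h := mk_rel (x := fX b (γ ++ false :: α) * fA γ)
    (y := fA γ * fX b (γ ++ false :: false :: α))
    ⟨γ, Or.inr <| Or.inr <| Or.inr <| Or.inl ⟨b, α, rfl⟩⟩
  simpa only [map_mul, mk_fX, mk_fA] using h

theorem rel_C0 (γ : Addr) (b : Bool) (α : Addr) :
    pX b (γ ++ false :: α) * pC γ = pC γ * pX b (γ ++ true :: α) := by
  have h := mk_rel (x := fX b (γ ++ false :: α) * fC γ)
    (y := fC γ * fX b (γ ++ true :: α))
    ⟨γ, Or.inr <| Or.inr <| Or.inr <| Or.inr <| Or.inl ⟨b, α, rfl⟩⟩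
  simpa only [map_mul, mk_fX, mk_fC] using h

theorem rel_C1 (γ : Addr) (b : Bool) (α : Addr) :
    pX b (γ ++ true :: α) * pC γ = pC γ * pX b (γ ++ false :: α) := by
  have h := mk_rel (x := fX b (γ ++ true :: α) * fC γ)
    (y := fC γ * fX b (γ ++ false :: α))
    ⟨γ, Or.inr <| Or.inr <| Or.inr <| Or.inr <| Or.inr <| Or.inl ⟨b, α, rfl⟩⟩
  simpa only [map_mul, mk_fX, mk_fC] using h

theorem rel_pent (γ : Addr) :
    pA γ * pA γ = pA (γ ++ [true]) * pA γ * pA (γ ++ [false]) := by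
  have h := mk_rel (x := fA γ * fA γ)
    (y := fA (γ ++ [true]) * fA γ * fA (γ ++ [false]))
    ⟨γ, Or.inr <| Or.inr <| Or.inr <| Or.inr <| Or.inr <| Or.inr <| Or.inl rfl⟩
  simpa only [map_mul, mk_fA] using h

theorem rel_hex (γ : Addr) :
    pA γ * pC γ * pA γ = pC (γ ++ [true]) * pA γ * pC (γ ++ [false]) := by
  have h := mk_rel (x := fA γ * fC γ * fA γ)
    (y := fC (γ ++ [true]) * fA γ * fC (γ ++ [false]))
    ⟨γ, Or.inr <| Or.inr <| Or.inr <| Or.inr <| Or.inr <| Or.inr <| Or.inr <| Or.inl rfl⟩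
  simpa only [map_mul, mk_fA, mk_fC] using h

theorem rel_hex' (γ : Addr) :
    (pA γ)⁻¹ * pC γ * (pA γ)⁻¹ = pC (γ ++ [false]) * (pA γ)⁻¹ * pC (γ ++ [true]) := by
  have h := mk_rel (x := (fA γ)⁻¹ * fC γ * (fA γ)⁻¹)
    (y := fC (γ ++ [false]) * (fA γ)⁻¹ * fC (γ ++ [true]))
    ⟨γ, Or.inr <| Or.inr <| Or.inr <| Or.inr <| Or.inr <| Or.inr <| Or.inr <| Or.inr <|
      Or.inl rfl⟩
  simpa only [map_mul, map_inv, mk_fA, mk_fC] using h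

theorem rel_CC (γ : Addr) : pC γ * pC γ = 1 := by
  have h : PresentedGroup.mk relsAC (fC γ * fC γ) = 1 := PresentedGroup.one_of_mem
    ⟨γ, Or.inr <| Or.inr <| Or.inr <| Or.inr <| Or.inr <| Or.inr <| Or.inr <| Or.inr <|
      Or.inr rfl⟩
  simpa only [map_mul, mk_fC] using h

theorem p_ind {p : P → Prop} (hX : ∀ b α, p (pX b α)) (h1 : p 1)
    (hm : ∀ x y, p x → p y → p (x * y)) (hi : ∀ x, p x → p x⁻¹) (x : P) : p x := by
  have hx : x ∈ Subgroup.closure (Set.range (PresentedGroup.of : GenAC → P)) := by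
    rw [PresentedGroup.closure_range_of]; trivial
  induction hx using Subgroup.closure_induction with
  | mem x h =>
    obtain ⟨g, rfl⟩ := h
    cases g with
    | A α => exact hX false α
    | C α => exact hX true α
  | one => exact h1
  | mul x y _ _ hx hy => exact hm x y hx hy
  | inv x _ hx => exact hi x hx

/-- General recipe: a map from the presented group. -/
theorem lift_ok {H : Type*} [Group H] (F : GenAC → H) (X : Bool → Addr → H)
    (hA : ∀ α, F (GenAC.A α) = X false α) (hC : ∀ α, F (GenAC.C α) = X true α)
    (h1 : ∀ (γ : Addr) (b b' : Bool) (α β : Addr),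
      X b (γ ++ false :: α) * X b' (γ ++ true :: β) =
      X b' (γ ++ true :: β) * X b (γ ++ false :: α))
    (h2 : ∀ (γ : Addr) (b : Bool) (α : Addr),
      X b (γ ++ true :: true :: α) * X false γ = X false γ * X b (γ ++ true :: α))
    (h3 : ∀ (γ : Addr) (b : Bool) (α : Addr),
      X b (γ ++ true :: false :: α) * X false γ = X false γ * X b (γ ++ false :: true :: α))
    (h4 : ∀ (γ : Addr) (b : Bool) (α : Addr),
      X b (γ ++ false :: α) * X false γ = X false γ * X b (γ ++ false :: false :: α))
    (h5 : ∀ (γ : Addr) (b : Bool) (α : Addr),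
      X b (γ ++ false :: α) * X true γ = X true γ * X b (γ ++ true :: α))
    (h6 : ∀ (γ : Addr) (b : Bool) (α : Addr),
      X b (γ ++ true :: α) * X true γ = X true γ * X b (γ ++ false :: α))
    (h7 : ∀ γ : Addr, X false γ * X false γ =
      X false (γ ++ [true]) * X false γ * X false (γ ++ [false]))
    (h8 : ∀ γ : Addr, X false γ * X true γ * X false γ =
      X true (γ ++ [true]) * X false γ * X true (γ ++ [false]))
    (h9 : ∀ γ : Addr, (X false γ)⁻¹ * X true γ * (X false γ)⁻¹ =
      X true (γ ++ [false]) * (X false γ)⁻¹ * X true (γ ++ [true]))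
    (h10 : ∀ γ : Addr, X true γ * X true γ = 1) :
    ∀ r ∈ relsAC, FreeGroup.lift F r = 1 := by
  have eX : ∀ b α, FreeGroup.lift F (fX b α) = X b α := by
    intro b α
    cases b
    · simp [fX, hA]
    · simp [fX, hC]
  have eA : ∀ α, FreeGroup.lift F (fA α) = X false α := fun α => eX false α
  have eC : ∀ α, FreeGroup.lift F (fC α) = X true α := fun α => eX true α
  rintro r ⟨γ, h⟩
  rcases h with ⟨b, b', α, β, rfl⟩ | ⟨b, α, rfl⟩ | ⟨b, α, rfl⟩ | ⟨b, α, rfl⟩ | ⟨b, α, rfl⟩ |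
    ⟨b, α, rfl⟩ | rfl | rfl | rfl | rfl
  · rw [map_mul _ _ (_⁻¹), map_inv, mul_inv_eq_one]
    simpa only [map_mul, eX] using h1 γ b b' α β
  · rw [map_mul _ _ (_⁻¹), map_inv, mul_inv_eq_one]
    simpa only [map_mul, eX, eA] using h2 γ b α
  · rw [map_mul _ _ (_⁻¹), map_inv, mul_inv_eq_one]
    simpa only [map_mul, eX, eA] using h3 γ b α
  · rw [map_mul _ _ (_⁻¹), map_inv, mul_inv_eq_one]
    simpa only [map_mul, eX, eA] using h4 γ b α
  · rw [map_mul _ _ (_⁻¹), map_inv, mul_inv_eq_one]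
    simpa only [map_mul, eX, eC] using h5 γ b α
  · rw [map_mul _ _ (_⁻¹), map_inv, mul_inv_eq_one]
    simpa only [map_mul, eX, eC] using h6 γ b α
  · rw [map_mul _ _ (_⁻¹), map_inv, mul_inv_eq_one]
    simpa only [map_mul, eA] using h7 γ
  · rw [map_mul _ _ (_⁻¹), map_inv, mul_inv_eq_one]
    simpa only [map_mul, eA, eC] using h8 γ
  · rw [map_mul _ _ ((_ * _ * _)⁻¹), map_inv _ (_ * _ * _), mul_inv_eq_one]
    simpa only [map_mul, map_inv, eA, eC] using h9 γ
  · simpa only [map_mul, eC] using h10 γ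

def shF (d : Bool) : GenAC → P
  | .A α => pX false (d :: α)
  | .C α => pX true (d :: α)

/-- The shift endomorphism. -/
def sh (d : Bool) : P →* P :=
  PresentedGroup.toGroup (f := shF d)
    (lift_ok (shF d) (fun b α => pX b (d :: α)) (fun _ => rfl) (fun _ => rfl)
      (fun γ => rel_comm (d :: γ)) (fun γ => rel_A11 (d :: γ)) (fun γ => rel_A10 (d :: γ))
      (fun γ => rel_A0 (d :: γ)) (fun γ => rel_C0 (d :: γ)) (fun γ => rel_C1 (d :: γ))
      (fun γ => rel_pent (d :: γ)) (fun γ => rel_hex (d :: γ)) (fun γ => rel_hex' (d :: γ))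
      (fun γ => rel_CC (d :: γ)))

theorem sh_pX (d b : Bool) (α : Addr) : sh d (pX b α) = pX b (d :: α) := by
  cases b
  · exact PresentedGroup.toGroup.of _
  · exact PresentedGroup.toGroup.of _

theorem semi_ind (u : P) (f g : P →* P) (h : ∀ b α, u * f (pX b α) = g (pX b α) * u) (x : P) :
    u * f x = g x * u := by
  refine p_ind (p := fun x => SemiconjBy u (f x) (g x)) h ?_ ?_ ?_ x
  · simp
  · intro x y hx hy
    rw [map_mul, map_mul]; exact hx.mul_right hy
  · intro x hx
    rw [map_inv, map_inv]; exact hx.inv_right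

theorem sh_comm (x y : P) : sh false x * sh true y = sh true y * sh false x := by
  have h : ∀ b α, ∀ y, pX b (false :: α) * sh true y = sh true y * pX b (false :: α) := by
    intro b α y
    refine semi_ind (pX b (false :: α)) (sh true) (sh true) ?_ y
    intro b' β
    rw [sh_pX]; exact rel_comm [] b b' α β
  refine (semi_ind (sh true y) (sh false) (sh false) ?_ x).symm
  intro b α
  rw [sh_pX]; exact (h b α y).symm

theorem sh_C (d : Bool) (x : P) : pC [] * sh d x = sh (!d) x * pC [] := by
  refine semi_ind (pC []) (sh d) (sh (!d)) ?_ x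
  intro b α
  rw [sh_pX, sh_pX]
  cases d
  · exact (rel_C1 [] b α).symm
  · exact (rel_C0 [] b α).symm

theorem sh_A1 (x : P) : pA [] * sh true x = sh true (sh true x) * pA [] := by
  refine semi_ind (pA []) (sh true) ((sh true).comp (sh true)) ?_ x
  intro b α
  simp only [MonoidHom.comp_apply, sh_pX]
  exact (rel_A11 [] b α).symm

theorem sh_A01 (x : P) : pA [] * sh false (sh true x) = sh true (sh false x) * pA [] := by
  refine semi_ind (pA []) ((sh false).comp (sh true)) ((sh true).comp (sh false)) ?_ x
  intro b α
  simp only [MonoidHom.comp_apply, sh_pX]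
  exact (rel_A10 [] b α).symm

theorem sh_A00 (x : P) : pA [] * sh false (sh false x) = sh false x * pA [] := by
  refine semi_ind (pA []) ((sh false).comp (sh false)) (sh false) ?_ x
  intro b α
  simp only [MonoidHom.comp_apply, sh_pX]
  exact (rel_A0 [] b α).symm

/-! ### Merging -/

/-- Element of the presented group describing how to merge two right combs whose
sets of labels are `s` and `u`, the labels being ordered as in the list. -/
def M : List ℕ+ → Finset ℕ+ → Finset ℕ+ → P
  | [], _, _ => 1
  | a :: L, s, u =>
    if a ∈ s then (if s ⊆ {a} then 1 else (pA [])⁻¹ * sh true (M L (s.erase a) u))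
    else if a ∈ u then
      pC [] * (if u ⊆ {a} then 1 else (pA [])⁻¹ * sh true (M L (u.erase a) s))
    else M L s u

theorem M_left {a : ℕ+} {L : List ℕ+} {s u : Finset ℕ+} (h : a ∈ s) :
    M (a :: L) s u =
      (if s ⊆ {a} then 1 else (pA [])⁻¹ * sh true (M L (s.erase a) u)) := by
  rw [M, if_pos h]

theorem M_none {a : ℕ+} {L : List ℕ+} {s u : Finset ℕ+} (h : a ∉ s) (h' : a ∉ u) :
    M (a :: L) s u = M L s u := by
  rw [M, if_neg h, if_neg h']

theorem sub_tail {a : ℕ+} {L : List ℕ+} {s : Finset ℕ+} (hs : ∀ x ∈ s, x ∈ a :: L)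
    (h : a ∉ s) : ∀ x ∈ s, x ∈ L := by
  intro x hx
  rcases List.mem_cons.mp (hs x hx) with rfl | h'
  · exact absurd hx h
  · exact h'

theorem sub_erase {a : ℕ+} {L : List ℕ+} {s : Finset ℕ+} (hs : ∀ x ∈ s, x ∈ a :: L) :
    ∀ x ∈ s.erase a, x ∈ L := by
  intro x hx
  rw [Finset.mem_erase] at hx
  rcases List.mem_cons.mp (hs x hx.2) with rfl | h'
  · exact absurd rfl hx.1
  · exact h'

theorem CC_mul (x : P) : pC [] * (pC [] * x) = x := by
  rw [← mul_assoc, rel_CC, one_mul]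

theorem M_comm (L : List ℕ+) : ∀ (s u : Finset ℕ+), (∀ x ∈ s, x ∈ L) →
    s.Nonempty → Disjoint s u → M L s u = pC [] * M L u s := by
  induction L with
  | nil =>
    intro s u hs hn _
    obtain ⟨x, hx⟩ := hn
    exact absurd (hs x hx) (by simp)
  | cons a L ih =>
    intro s u hs hn hd
    by_cases ha : a ∈ s
    · have hu : a ∉ u := Finset.disjoint_left.mp hd ha
      simp only [M, if_pos ha, if_neg hu]
      rw [CC_mul]
    · by_cases hu : a ∈ u
      · simp only [M, if_pos hu, if_neg ha]
      · rw [M_none ha hu, M_none hu ha]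
        exact ih s u (sub_tail hs ha) hn hd

theorem eA1 : (pA [])⁻¹ * sh true (pA []) =
    pA [] * sh false (pA [])⁻¹ * (pA [])⁻¹ := by
  have h := rel_pent []
  rw [map_inv, sh_pX, sh_pX]
  simp only [List.nil_append] at h
  rw [eq_mul_inv_iff_mul_eq, eq_mul_inv_iff_mul_eq, mul_assoc, mul_assoc, inv_mul_eq_iff_eq_mul,
    ← mul_assoc]
  exact h.symm

theorem hexC : pC [] * sh false (pC []) * (pA [])⁻¹ * sh true (pC []) * pC [] = pA [] := by
  have h := rel_hex' []
  have h8 := rel_hex []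
  rw [sh_pX, sh_pX]
  simp only [List.nil_append] at h h8
  have c0 := rel_CC []
  have c1 := rel_CC [true]
  have hc : pC [false] * pC [] = pC [] * pC [true] := rel_C0 [] true []
  have e : pC [] * pC [false] * (pA [])⁻¹ * pC [true] * pC [] =
      pC [] * ((pA [])⁻¹ * pC [] * (pA [])⁻¹) * pC [] := by
    rw [h]; simp only [mul_assoc]
  rw [e]
  -- X = A C satisfies X ^ 2 = C₁ X C₁
  generalize pA [] = A at *
  generalize pC [] = C at *
  generalize pC [true] = D at *
  generalize pC [false] = E at *
  have hX : (A * C) * (A * C) = D * (A * C) * D := by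
    calc (A * C) * (A * C) = (A * C * A) * C := by simp only [mul_assoc]
      _ = D * A * (E * C) := by rw [h8]; simp only [mul_assoc]
      _ = D * (A * C) * D := by rw [hc]; simp only [mul_assoc]
  have hX4 : (A * C) * (A * C) * ((A * C) * (A * C)) = A * C := by
    calc (A * C) * (A * C) * ((A * C) * (A * C))
        = (D * (A * C) * D) * (D * (A * C) * D) := by rw [hX]
      _ = D * (A * C) * (D * D) * (A * C) * D := by simp only [mul_assoc]
      _ = D * ((A * C) * (A * C)) * D := by rw [c1]; simp only [mul_assoc, one_mul]
      _ = (D * D) * (A * C) * (D * D) := by rw [hX]; simp only [mul_assoc]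
      _ = A * C := by rw [c1]; simp
  have hX3 : (A * C) * (A * C) * (A * C) = 1 := by
    have : (A * C) * (A * C) * (A * C) * (A * C) = 1 * (A * C) := by
      rw [one_mul]; simpa only [mul_assoc] using hX4
    exact mul_right_cancel this
  have hCi : C⁻¹ = C := inv_eq_of_mul_eq_one_right c0
  have : (C * (A⁻¹ * C * A⁻¹) * C) * A⁻¹ = ((A * C) * (A * C) * (A * C))⁻¹ := by
    simp only [mul_inv_rev, hCi, mul_assoc]
  rw [hX3, inv_one] at this
  exact mul_inv_eq_one.mp this

/-- The compatibility of merging with associativity. -/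
def T (L : List ℕ+) (s₁ s₂ s₃ : Finset ℕ+) : Prop :=
  sh true (M L s₂ s₃) * M L s₁ (s₂ ∪ s₃) = pA [] * sh false (M L s₁ s₂) * M L (s₁ ∪ s₂) s₃

structure Ok (L : List ℕ+) (s₁ s₂ s₃ : Finset ℕ+) : Prop where
  m1 : ∀ x ∈ s₁, x ∈ L
  m2 : ∀ x ∈ s₂, x ∈ L
  m3 : ∀ x ∈ s₃, x ∈ L
  n1 : s₁.Nonempty
  n2 : s₂.Nonempty
  n3 : s₃.Nonempty
  d12 : Disjoint s₁ s₂
  d13 : Disjoint s₁ s₃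
  d23 : Disjoint s₂ s₃

theorem T_rev {L : List ℕ+} {s₁ s₂ s₃ : Finset ℕ+} (ok : Ok L s₁ s₂ s₃)
    (h : T L s₃ s₂ s₁) : T L s₁ s₂ s₃ := by
  unfold T at *
  have m12 : ∀ x ∈ s₁ ∪ s₂, x ∈ L := fun x hx =>
    (Finset.mem_union.mp hx).elim (ok.m1 x) (ok.m2 x)
  have m23 : ∀ x ∈ s₂ ∪ s₃, x ∈ L := fun x hx =>
    (Finset.mem_union.mp hx).elim (ok.m2 x) (ok.m3 x)
  rw [Finset.union_comm s₂ s₁, Finset.union_comm s₃ s₂,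
    M_comm L s₂ s₁ ok.m2 ok.n2 ok.d12.symm,
    M_comm L s₃ (s₁ ∪ s₂) ok.m3 ok.n3
      (Finset.disjoint_union_right.mpr ⟨ok.d13.symm, ok.d23.symm⟩),
    M_comm L s₃ s₂ ok.m3 ok.n3 ok.d23.symm,
    M_comm L (s₂ ∪ s₃) s₁ m23 (ok.n2.mono Finset.subset_union_left)
      (Finset.disjoint_union_left.mpr ⟨ok.d12.symm, ok.d13.symm⟩)] at h
  generalize M L s₁ s₂ = a at *
  generalize M L (s₁ ∪ s₂) s₃ = b at *
  generalize M L s₂ s₃ = c at *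
  generalize M L s₁ (s₂ ∪ s₃) = d at *
  have e1 : sh true (pC [] * a) * (pC [] * b) = sh true (pC []) * pC [] * (sh false a * b) := by
    rw [map_mul, mul_assoc, ← mul_assoc (sh true a), ← Bool.not_false, ← sh_C]
    simp only [mul_assoc]
  have e2 : pA [] * sh false (pC [] * c) * (pC [] * d) =
      pA [] * sh false (pC []) * pC [] * (sh true c * d) := by
    rw [map_mul, mul_assoc, mul_assoc (sh false (pC [])), ← mul_assoc (sh false c),
      ← Bool.not_true, ← sh_C]
    simp only [mul_assoc]
  rw [e1, e2] at h
  have h0 : sh false (pC []) * sh false (pC []) = 1 := by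
    rw [← map_mul, rel_CC, map_one]
  calc sh true c * d = pC [] * sh false (pC []) * (pA [])⁻¹ *
        (pA [] * sh false (pC []) * pC [] * (sh true c * d)) := by
        have : pC [] * sh false (pC []) * (pA [])⁻¹ *
          (pA [] * sh false (pC []) * pC [] * (sh true c * d)) =
          pC [] * (sh false (pC []) * sh false (pC [])) * pC [] * (sh true c * d) := by group
        rw [this, h0, mul_one, rel_CC, one_mul]
    _ = pC [] * sh false (pC []) * (pA [])⁻¹ * sh true (pC []) * pC [] * (sh false a * b) := by
        rw [← h]; simp only [mul_assoc]
    _ = pA [] * sh false a * b := by rw [hexC]; simp only [mul_assoc]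

theorem T_mid {L : List ℕ+} {s₁ s₂ s₃ : Finset ℕ+} (ok : Ok L s₁ s₂ s₃)
    (h : T L s₂ s₃ s₁) (h' : T L s₂ s₁ s₃) : T L s₁ s₂ s₃ := by
  unfold T at *
  have m23 : ∀ x ∈ s₂ ∪ s₃, x ∈ L := fun x hx =>
    (Finset.mem_union.mp hx).elim (ok.m2 x) (ok.m3 x)
  rw [M_comm L s₃ s₁ ok.m3 ok.n3 ok.d13.symm, Finset.union_comm s₃ s₁, map_mul, mul_assoc, h',
    Finset.union_comm s₂ s₁,
    M_comm L s₂ s₁ ok.m2 ok.n2 ok.d12.symm,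
    M_comm L (s₂ ∪ s₃) s₁ m23 (ok.n2.mono Finset.subset_union_left)
      (Finset.disjoint_union_left.mpr ⟨ok.d12.symm, ok.d13.symm⟩)] at h
  clear h'
  generalize M L s₁ s₂ = a at *
  generalize M L (s₁ ∪ s₂) s₃ = b at *
  generalize M L s₂ s₃ = c at *
  generalize M L s₁ (s₂ ∪ s₃) = d at *
  have h8 := rel_hex []
  simp only [List.nil_append] at h8
  have e2 : pA [] * sh false c * (pC [] * d) = pA [] * pC [] * (sh true c * d) := by
    rw [mul_assoc, ← mul_assoc (sh false c), ← Bool.not_true, ← sh_C]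
    simp only [mul_assoc]
  have e1 : sh true (pC []) * (pA [] * sh false (pC [] * a) * b) =
      pA [] * pC [] * (pA [] * sh false a * b) := by
    rw [map_mul, sh_pX, sh_pX]
    have : pX true [true] * (pA [] * (pX true [false] * sh false a) * b) =
      (pC [true] * pA [] * pC [false]) * (sh false a * b) := by simp only [mul_assoc]
    rw [this, ← h8]; simp only [mul_assoc]
  rw [e1, e2] at h
  exact (mul_left_cancel h).symm

theorem T_first {a : ℕ+} {L : List ℕ+}
    (ih : ∀ s₁ s₂ s₃, Ok L s₁ s₂ s₃ → T L s₁ s₂ s₃) {s₁ s₂ s₃ : Finset ℕ+}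
    (ok : Ok (a :: L) s₁ s₂ s₃) (ha : a ∈ s₁) : T (a :: L) s₁ s₂ s₃ := by
  have a2 : a ∉ s₂ := Finset.disjoint_left.mp ok.d12 ha
  have a3 : a ∉ s₃ := Finset.disjoint_left.mp ok.d13 ha
  have a12 : a ∈ s₁ ∪ s₂ := Finset.mem_union_left _ ha
  have hns : ¬ (s₁ ∪ s₂ ⊆ {a}) := by
    obtain ⟨x, hx⟩ := ok.n2
    intro h
    have := Finset.mem_singleton.mp (h (Finset.mem_union_right _ hx))
    exact a2 (this ▸ hx)
  unfold T
  rw [M_left ha, M_left ha, M_left a12, M_none a2 a3, if_neg hns, Finset.erase_union_distrib,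
    Finset.erase_eq_of_notMem a2]
  by_cases h : s₁ ⊆ {a}
  · rw [if_pos h, if_pos h]
    have : s₁.erase a = ∅ := by
      rw [Finset.eq_empty_iff_forall_notMem]
      intro x hx
      rw [Finset.mem_erase] at hx
      exact hx.1 (Finset.mem_singleton.mp (h hx.2))
    rw [this, Finset.empty_union]
    simp
  · rw [if_neg h, if_neg h]
    have n1 : (s₁.erase a).Nonempty := by
      rw [Finset.subset_iff] at h
      push Not at h
      obtain ⟨x, hx, hxa⟩ := h
      exact ⟨x, Finset.mem_erase.mpr ⟨fun e => hxa (by simp [e]), hx⟩⟩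
    have hT := ih (s₁.erase a) s₂ s₃
      ⟨sub_erase ok.m1, sub_tail ok.m2 a2, sub_tail ok.m3 a3, n1, ok.n2, ok.n3,
        ok.d12.mono_left (Finset.erase_subset _ _), ok.d13.mono_left (Finset.erase_subset _ _),
        ok.d23⟩
    unfold T at hT
    generalize M L s₂ s₃ = x at *
    generalize M L (s₁.erase a) (s₂ ∪ s₃) = y at *
    generalize M L (s₁.erase a) s₂ = z at *
    generalize M L (s₁.erase a ∪ s₂) s₃ = w at *
    have f1 : sh true x * (pA [])⁻¹ = (pA [])⁻¹ * sh true (sh true x) := by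
      rw [mul_inv_eq_iff_eq_mul, mul_assoc, ← sh_A1, inv_mul_cancel_left]
    have f2 : sh false (sh true z) * (pA [])⁻¹ = (pA [])⁻¹ * sh true (sh false z) := by
      rw [mul_inv_eq_iff_eq_mul, mul_assoc, ← sh_A01, inv_mul_cancel_left]
    calc sh true x * ((pA [])⁻¹ * sh true y)
        = (pA [])⁻¹ * sh true (sh true x * y) := by
          rw [← mul_assoc, f1, map_mul]; simp only [mul_assoc]
      _ = ((pA [])⁻¹ * sh true (pA [])) * (sh true (sh false z) * sh true w) := by
          rw [hT, map_mul, map_mul]; simp only [mul_assoc]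
      _ = pA [] * sh false (pA [])⁻¹ * ((pA [])⁻¹ * sh true (sh false z)) * sh true w := by
          rw [eA1]; simp only [mul_assoc]
      _ = pA [] * sh false ((pA [])⁻¹ * sh true z) * ((pA [])⁻¹ * sh true w) := by
          rw [← f2, map_mul]; simp only [mul_assoc]

theorem Ok.perm213 {L : List ℕ+} {s₁ s₂ s₃ : Finset ℕ+} (ok : Ok L s₁ s₂ s₃) :
    Ok L s₂ s₁ s₃ :=
  ⟨ok.m2, ok.m1, ok.m3, ok.n2, ok.n1, ok.n3, ok.d12.symm, ok.d23, ok.d13⟩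

theorem Ok.perm231 {L : List ℕ+} {s₁ s₂ s₃ : Finset ℕ+} (ok : Ok L s₁ s₂ s₃) :
    Ok L s₂ s₃ s₁ :=
  ⟨ok.m2, ok.m3, ok.m1, ok.n2, ok.n3, ok.n1, ok.d23, ok.d12.symm, ok.d13.symm⟩

theorem Ok.perm321 {L : List ℕ+} {s₁ s₂ s₃ : Finset ℕ+} (ok : Ok L s₁ s₂ s₃) :
    Ok L s₃ s₂ s₁ :=
  ⟨ok.m3, ok.m2, ok.m1, ok.n3, ok.n2, ok.n1, ok.d23.symm, ok.d13.symm, ok.d12.symm⟩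

theorem T_all (L : List ℕ+) : ∀ s₁ s₂ s₃, Ok L s₁ s₂ s₃ → T L s₁ s₂ s₃ := by
  induction L with
  | nil =>
    intro s₁ s₂ s₃ ok
    obtain ⟨x, hx⟩ := ok.n1
    exact absurd (ok.m1 x hx) (by simp)
  | cons a L ih =>
    intro s₁ s₂ s₃ ok
    by_cases h1 : a ∈ s₁
    · exact T_first ih ok h1
    by_cases h3 : a ∈ s₃
    · exact T_rev ok (T_first ih ok.perm321 h3)
    by_cases h2 : a ∈ s₂
    · exact T_mid ok (T_first ih ok.perm231 h2) (T_first ih ok.perm213 h2)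
    have h12 : a ∉ s₁ ∪ s₂ := by simp [h1, h2]
    have h23 : a ∉ s₂ ∪ s₃ := by simp [h2, h3]
    unfold T
    rw [M_none h2 h3, M_none h1 h23, M_none h1 h2, M_none h12 h3]
    exact ih s₁ s₂ s₃ ⟨sub_tail ok.m1 h1, sub_tail ok.m2 h2, sub_tail ok.m3 h3, ok.n1, ok.n2,
      ok.n3, ok.d12, ok.d13, ok.d23⟩

/-! ### Normalising trees -/

def lv : CTree → Finset ℕ+
  | .leaf a => {a}
  | .node t₁ t₂ => lv t₁ ∪ lv t₂

/-- Trees with pairwise distinct labels. -/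
def Good : CTree → Prop
  | .leaf _ => True
  | .node t₁ t₂ => Good t₁ ∧ Good t₂ ∧ Disjoint (lv t₁) (lv t₂)

def nf (L : List ℕ+) : CTree → P
  | .leaf _ => 1
  | .node t₁ t₂ => sh false (nf L t₁) * sh true (nf L t₂) * M L (lv t₁) (lv t₂)

theorem lv_nonempty (t : CTree) : (lv t).Nonempty := by
  induction t with
  | leaf a => exact ⟨a, by simp [lv]⟩
  | node t₁ t₂ h₁ _ => exact h₁.mono Finset.subset_union_left

def Rel (f : PMap) (x : P) : Prop :=
  ∀ (L : List ℕ+) (t t' : CTree), Good t → (∀ a ∈ lv t, a ∈ L) → f t = some t' →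
    Good t' ∧ lv t' = lv t ∧ nf L t = x * nf L t'

theorem rel_one : Rel 1 1 := by
  intro L t t' hg _ h
  have : t = t' := Option.some.inj h
  subst this
  exact ⟨hg, rfl, (one_mul _).symm⟩

theorem rel_mul {f g : PMap} {x y : P} (hf : Rel f x) (hg : Rel g y) : Rel (f * g) (x * y) := by
  intro L t t' hG hL h
  have h' : (f t).bind g = some t' := h
  obtain ⟨u, hu, hut⟩ := Option.bind_eq_some_iff.mp h'
  obtain ⟨h1, h2, h3⟩ := hf L t u hG hL hu
  obtain ⟨k1, k2, k3⟩ := hg L u t' h1 (by rw [h2]; exact hL) hut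
  exact ⟨k1, k2.trans h2, by rw [h3, k3, mul_assoc]⟩

theorem rel_at {f : PMap} {x : P} (d : Bool) (α : Addr)
    (ih : Rel (applyAt α f) x) : Rel (applyAt (d :: α) f) (sh d x) := by
  intro L t t' hg hL ht
  cases t with
  | leaf a => cases d <;> simp [applyAt] at ht
  | node t₁ t₂ =>
    obtain ⟨g1, g2, g3⟩ := hg
    cases d
    · simp only [applyAt, Option.map_eq_some_iff] at ht
      obtain ⟨u, hu, rfl⟩ := ht
      obtain ⟨k1, k2, k3⟩ := ih L t₁ u g1 (fun a ha => hL a (Finset.mem_union_left _ ha)) hu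
      refine ⟨⟨k1, g2, by rw [k2]; exact g3⟩, by simp [lv, k2], ?_⟩
      simp only [nf, k3, k2, map_mul, mul_assoc]
    · simp only [applyAt, Option.map_eq_some_iff] at ht
      obtain ⟨u, hu, rfl⟩ := ht
      obtain ⟨k1, k2, k3⟩ := ih L t₂ u g2 (fun a ha => hL a (Finset.mem_union_right _ ha)) hu
      refine ⟨⟨g1, k1, by rw [k2]; exact g3⟩, by simp [lv, k2], ?_⟩
      simp only [nf, k3, k2, map_mul]
      rw [← mul_assoc (sh false _), sh_comm]
      simp only [mul_assoc]

theorem rel_C (α : Addr) : Rel (applyAt α opC) (pC α) := by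
  induction α with
  | nil =>
    intro L t t' hg hL ht
    cases t with
    | leaf a => simp [applyAt, opC] at ht
    | node t₁ t₂ =>
      obtain ⟨g1, g2, g3⟩ := hg
      simp only [applyAt, opC, Option.some.injEq] at ht
      subst ht
      refine ⟨⟨g2, g1, g3.symm⟩, Finset.union_comm _ _, ?_⟩
      simp only [nf]
      rw [M_comm L (lv t₁) (lv t₂) (fun a ha => hL a (Finset.mem_union_left _ ha))
        (lv_nonempty _) g3]
      have e1 := sh_C false (nf L t₂)
      have e2 := sh_C true (nf L t₁)
      simp only [Bool.not_false, Bool.not_true] at e1 e2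
      simp only [← mul_assoc]
      rw [e1, mul_assoc (sh true _) (pC []), e2, ← mul_assoc (sh true _), sh_comm]
  | cons d α ih =>
    rw [pC, ← sh_pX]
    exact rel_at d α ih

theorem rel_A (α : Addr) : Rel (applyAt α opA) (pA α) := by
  induction α with
  | nil =>
    intro L t t' hg hL ht
    rcases t with a | ⟨t₁, a | ⟨t₂, t₃⟩⟩
    · simp [applyAt, opA] at ht
    · simp [applyAt, opA] at ht
    · obtain ⟨g1, ⟨g2, g3, d23⟩, d1⟩ := hg
      simp only [applyAt, opA, Option.some.injEq] at ht
      subst ht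
      have d12 : Disjoint (lv t₁) (lv t₂) := (Finset.disjoint_union_right.mp d1).1
      have d13 : Disjoint (lv t₁) (lv t₃) := (Finset.disjoint_union_right.mp d1).2
      refine ⟨⟨⟨g1, g2, d12⟩, g3, Finset.disjoint_union_left.mpr ⟨d13, d23⟩⟩,
        Finset.union_assoc _ _ _, ?_⟩
      have hT := T_all L (lv t₁) (lv t₂) (lv t₃)
        ⟨fun a ha => hL a (by simp [lv, ha]), fun a ha => hL a (by simp [lv, ha]),
          fun a ha => hL a (by simp [lv, ha]), lv_nonempty _, lv_nonempty _, lv_nonempty _,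
          d12, d13, d23⟩
      unfold T at hT
      simp only [nf, lv]
      generalize M L (lv t₂) (lv t₃) = x at *
      generalize M L (lv t₁) (lv t₂ ∪ lv t₃) = y at *
      generalize M L (lv t₁) (lv t₂) = z at *
      generalize M L (lv t₁ ∪ lv t₂) (lv t₃) = w at *
      generalize nf L t₁ = n₁
      generalize nf L t₂ = n₂
      generalize nf L t₃ = n₃
      calc sh false n₁ * sh true (sh false n₂ * sh true n₃ * x) * y
          = sh false n₁ * sh true (sh false n₂) * sh true (sh true n₃) * (sh true x * y) := by
            simp only [map_mul, mul_assoc]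
        _ = sh false n₁ * sh true (sh false n₂) * (sh true (sh true n₃) * pA []) *
              sh false z * w := by
            rw [hT]; simp only [mul_assoc]
        _ = sh false n₁ * (sh true (sh false n₂) * pA []) * (sh true n₃ * sh false z) * w := by
            rw [← sh_A1]; simp only [mul_assoc]
        _ = (sh false n₁ * pA []) * sh false (sh true n₂) * (sh true n₃ * sh false z) * w := by
            rw [← sh_A01]; simp only [mul_assoc]
        _ = pA [] * sh false (sh false n₁) * sh false (sh true n₂) *
              (sh false z * sh true n₃) * w := by
            rw [← sh_A00, sh_comm]
        _ = pA [] * (sh false (sh false n₁ * sh true n₂ * z) * sh true n₃ * w) := by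
            simp only [map_mul, mul_assoc]
  | cons d α ih =>
    rw [pA, ← sh_pX]
    exact rel_at d α ih

theorem rel_Ai_nil : Rel opAi (pA [])⁻¹ := by
  intro L t t' hg hL ht
  rcases t with a | ⟨a | ⟨t₁, t₂⟩, t₃⟩
  · simp [opAi] at ht
  · simp [opAi] at ht
  · simp only [opAi, Option.some.injEq] at ht
    subst ht
    obtain ⟨⟨g1, g2, d12⟩, g3, d3⟩ := hg
    have d13 : Disjoint (lv t₁) (lv t₃) := (Finset.disjoint_union_left.mp d3).1
    have d23 : Disjoint (lv t₂) (lv t₃) := (Finset.disjoint_union_left.mp d3).2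
    have hg' : Good (.node t₁ (.node t₂ t₃)) :=
      ⟨g1, ⟨g2, g3, d23⟩, Finset.disjoint_union_right.mpr ⟨d12, d13⟩⟩
    have hl : lv (.node t₁ (.node t₂ t₃)) = lv (.node (.node t₁ t₂) t₃) :=
      (Finset.union_assoc _ _ _).symm
    refine ⟨hg', hl, ?_⟩
    have := (rel_A [] L _ (.node (.node t₁ t₂) t₃) hg' (by rw [hl]; exact hL) rfl).2.2
    rw [this, inv_mul_cancel_left]

theorem rel_Ai (α : Addr) : Rel (applyAt α opAi) (pA α)⁻¹ := by
  induction α with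
  | nil => exact rel_Ai_nil
  | cons d α ih =>
    rw [pA, ← sh_pX, ← map_inv]
    exact rel_at d α ih

/-! ### Relabelling -/

/-- Forget the labels. -/
def shape : CTree → CTree
  | .leaf _ => .leaf 1
  | .node t₁ t₂ => .node (shape t₁) (shape t₂)

def Nat' (f : PMap) : Prop := ∀ t, f (shape t) = (f t).map shape

theorem nat_at {f : PMap} (h : Nat' f) (α : Addr) : Nat' (applyAt α f) := by
  induction α with
  | nil => exact h
  | cons d α ih =>
    intro t
    rcases t with a | ⟨t₁, t₂⟩
    · cases d <;> rfl
    · cases d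
      · have := ih t₁
        simp only [shape, applyAt, this]
        cases applyAt α f t₁ <;> rfl
      · have := ih t₂
        simp only [shape, applyAt, this]
        cases applyAt α f t₂ <;> rfl

theorem nat_geo (f : PMap) (hf : f ∈ GeoAC) : Nat' f := by
  induction hf using Submonoid.closure_induction with
  | mem f h =>
    obtain ⟨α, rfl | rfl | rfl⟩ := h
    · apply nat_at
      rintro (a | ⟨t₁, a | ⟨t₂, t₃⟩⟩) <;> rfl
    · apply nat_at
      rintro (a | ⟨a | ⟨t₁, t₂⟩, t₃⟩) <;> rfl
    · apply nat_at
      rintro (a | ⟨t₁, t₂⟩) <;> rfl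
  | one => intro t; rfl
  | mul f g _ _ hf hg =>
    intro t
    show (f (shape t)).bind g = ((f t).bind g).map shape
    rw [hf t]
    cases f t with
    | none => rfl
    | some u => exact hg u

theorem exists_good (t : CTree) : ∀ k : ℕ+, ∃ (u : CTree) (m : ℕ+), shape u = shape t ∧ Good u ∧
    k ≤ m ∧ ∀ x ∈ lv u, k ≤ x ∧ x < m := by
  induction t with
  | leaf a =>
    intro k
    refine ⟨.leaf k, k + 1, rfl, trivial, (PNat.lt_add_right k 1).le, ?_⟩
    intro x hx
    rw [lv, Finset.mem_singleton] at hx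
    subst hx
    exact ⟨le_rfl, PNat.lt_add_right x 1⟩
  | node t₁ t₂ h₁ h₂ =>
    intro k
    obtain ⟨u₁, m₁, e₁, g₁, l₁, b₁⟩ := h₁ k
    obtain ⟨u₂, m₂, e₂, g₂, l₂, b₂⟩ := h₂ m₁
    refine ⟨.node u₁ u₂, m₂, by simp [shape, e₁, e₂], ⟨g₁, g₂, ?_⟩, l₁.trans l₂, ?_⟩
    · rw [Finset.disjoint_left]
      intro x hx hx'
      exact absurd (b₁ x hx).2 (not_lt.mpr (b₂ x hx').1)
    · intro x hx
      rcases Finset.mem_union.mp hx with hx | hx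
      · exact ⟨(b₁ x hx).1, (b₁ x hx).2.trans_le l₂⟩
      · exact ⟨l₁.trans (b₂ x hx).1, (b₂ x hx).2⟩

/-- An element related to a map near-equal to the identity is trivial. -/
theorem eq_one_of_near {f : PMap} {x : P} (hf : f ∈ GeoAC) (hr : Rel f x)
    (hn : NearEq f 1) : x = 1 := by
  obtain ⟨⟨t, ht, -⟩, h2⟩ := hn
  obtain ⟨u, -, hu, hg, -, -⟩ := exists_good t 1
  have hd : (f u).isSome := by
    have e1 := nat_geo f hf t
    have e2 := nat_geo f hf u
    rw [hu, e1] at e2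
    cases h : f u with
    | some v => rfl
    | none =>
      rw [h] at e2
      cases h' : f t with
      | none => rw [h'] at ht; exact ht
      | some v => rw [h'] at e2; simp at e2
  have hfu : f u = some u := h2 u hd rfl
  have := (hr (lv u).toList u u hg (by simp) hfu).2.2
  exact (mul_eq_right.mp this.symm)

/-! ### Relations between partial maps -/

theorem pmul_apply (f g : PMap) (t : CTree) : (f * g) t = (f t).bind g := rfl

theorem at_append (γ α : Addr) (f : PMap) :
    applyAt (γ ++ α) f = applyAt γ (applyAt α f) := by
  induction γ with
  | nil => rfl
  | cons d γ ih =>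
    funext t
    rcases t with a | ⟨t₁, t₂⟩
    · cases d <;> rfl
    · cases d <;> simp only [List.cons_append, applyAt, ih]

theorem at_mul (γ : Addr) (f g : PMap) :
    applyAt γ (f * g) = applyAt γ f * applyAt γ g := by
  induction γ with
  | nil => rfl
  | cons d γ ih =>
    funext t
    rcases t with a | ⟨t₁, t₂⟩
    · cases d <;> rfl
    · cases d
      · simp only [pmul_apply, applyAt, ih]
        cases h : applyAt γ f t₁ <;> rfl
      · simp only [pmul_apply, applyAt, ih]
        cases h : applyAt γ f t₂ <;> rfl

def opX : Bool → PMap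
  | false => opA
  | true => opC

theorem memX (b : Bool) (α : Addr) : applyAt α (opX b) ∈ GeoAC := by
  cases b
  · exact memA α
  · exact memC α

theorem memAi (α : Addr) : applyAt α opAi ∈ GeoAC :=
  Submonoid.subset_closure ⟨α, Or.inr (Or.inl rfl)⟩

/-- Sub-identities. -/
def SubId (f : PMap) : Prop := ∀ t s, f t = some s → s = t

theorem subId_at {f : PMap} (h : SubId f) (α : Addr) : SubId (applyAt α f) := by
  induction α with
  | nil => exact h
  | cons d α ih =>
    intro t s hs
    rcases t with a | ⟨t₁, t₂⟩
    · cases d <;> simp [applyAt] at hs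
    · cases d
      · simp only [applyAt, Option.map_eq_some_iff] at hs
        obtain ⟨u, hu, rfl⟩ := hs
        rw [ih t₁ u hu]
      · simp only [applyAt, Option.map_eq_some_iff] at hs
        obtain ⟨u, hu, rfl⟩ := hs
        rw [ih t₂ u hu]

section
variable {G : Type*} [Group G] (q : GeoAC →* G)

def qX (b : Bool) (α : Addr) : G := q ⟨applyAt α (opX b), memX b α⟩
def qAi (α : Addr) : G := q ⟨applyAt α opAi, memAi α⟩

theorem q_subId (hiff : ∀ f g : GeoAC, q f = q g ↔ NearEq f.1 g.1) (f : GeoAC)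
    (h : SubId f.1) : q f = 1 := by
  rw [← map_one q, hiff]
  obtain ⟨⟨t, ht, -⟩, -⟩ := (hiff f f).mp rfl
  refine ⟨⟨t, ht, rfl⟩, ?_⟩
  intro t ht _
  obtain ⟨s, hs⟩ := Option.isSome_iff_exists.mp ht
  rw [hs, h t s hs]; rfl

theorem qA_mul_qAi (hiff : ∀ f g : GeoAC, q f = q g ↔ NearEq f.1 g.1) (α : Addr) :
    qX q false α * qAi q α = 1 := by
  unfold qX qAi
  rw [← map_mul]
  apply q_subId q hiff
  show SubId (applyAt α opA * applyAt α opAi)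
  rw [← at_mul]
  apply subId_at
  rintro (a | ⟨t₁, a | ⟨t₂, t₃⟩⟩) s hs
  · simp [pmul_apply, opA] at hs
  · simp [pmul_apply, opA] at hs
  · simp [pmul_apply, opA, opAi] at hs
    exact hs.symm

theorem qCC (hiff : ∀ f g : GeoAC, q f = q g ↔ NearEq f.1 g.1) (α : Addr) :
    qX q true α * qX q true α = 1 := by
  unfold qX
  rw [← map_mul]
  apply q_subId q hiff
  show SubId (applyAt α opC * applyAt α opC)
  rw [← at_mul]
  apply subId_at
  rintro (a | ⟨t₁, t₂⟩) s hs
  · simp [pmul_apply, opC] at hs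
  · simp [pmul_apply, opC] at hs
    exact hs.symm

theorem comm_maps (α β : Addr) (f g : PMap) :
    applyAt (false :: α) f * applyAt (true :: β) g =
      applyAt (true :: β) g * applyAt (false :: α) f := by
  funext t
  rcases t with a | ⟨t₁, t₂⟩
  · rfl
  · simp only [pmul_apply, applyAt]
    cases h1 : applyAt α f t₁ <;> cases h2 : applyAt β g t₂ <;> simp [h1, h2]

theorem A11_maps (α : Addr) (f : PMap) :
    applyAt (true :: true :: α) f * opA = opA * applyAt (true :: α) f := by
  funext t
  rcases t with a | ⟨t₁, a | ⟨t₂, t₃⟩⟩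
  · rfl
  · rfl
  · simp only [pmul_apply, applyAt, opA]
    cases h : applyAt α f t₃ <;> simp [h, opA]

theorem A10_maps (α : Addr) (f : PMap) :
    applyAt (true :: false :: α) f * opA = opA * applyAt (false :: true :: α) f := by
  funext t
  rcases t with a | ⟨t₁, a | ⟨t₂, t₃⟩⟩
  · rfl
  · rfl
  · simp only [pmul_apply, applyAt, opA]
    cases h : applyAt α f t₂ <;> simp [h, opA]

theorem A0_maps (α : Addr) (f : PMap) :
    applyAt (false :: α) f * opA = opA * applyAt (false :: false :: α) f := by
  funext t
  rcases t with a | ⟨t₁, a | ⟨t₂, t₃⟩⟩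
  · rfl
  · simp only [pmul_apply, applyAt, opA]
    cases h : applyAt α f t₁ <;> simp [opA]
  · simp only [pmul_apply, applyAt, opA]
    cases h : applyAt α f t₁ <;> simp [h, opA]

theorem C0_maps (α : Addr) (f : PMap) :
    applyAt (false :: α) f * opC = opC * applyAt (true :: α) f := by
  funext t
  rcases t with a | ⟨t₁, t₂⟩
  · rfl
  · simp only [pmul_apply, applyAt, opC]
    cases h : applyAt α f t₁ <;> simp [h, opC]

theorem C1_maps (α : Addr) (f : PMap) :
    applyAt (true :: α) f * opC = opC * applyAt (false :: α) f := by
  funext t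
  rcases t with a | ⟨t₁, t₂⟩
  · rfl
  · simp only [pmul_apply, applyAt, opC]
    cases h : applyAt α f t₂ <;> simp [h, opC]

theorem pent_maps : opA * opA = applyAt [true] opA * opA * applyAt [false] opA := by
  funext t
  rcases t with a | ⟨t₁, a | ⟨t₂, a | ⟨t₃, t₄⟩⟩⟩ <;> rfl

theorem hex_maps : opA * opC * opA = applyAt [true] opC * opA * applyAt [false] opC := by
  funext t
  rcases t with a | ⟨t₁, a | ⟨t₂, t₃⟩⟩ <;> rfl

theorem hex_maps' : opAi * opC * opAi = applyAt [false] opC * opAi * applyAt [true] opC := by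
  funext t
  rcases t with a | ⟨a | ⟨t₁, t₂⟩, t₃⟩ <;> rfl

theorem q_eq2 {f g f' g' : PMap} (hf : f ∈ GeoAC) (hg : g ∈ GeoAC) (hf' : f' ∈ GeoAC)
    (hg' : g' ∈ GeoAC) (h : f * g = f' * g') :
    q ⟨f, hf⟩ * q ⟨g, hg⟩ = q ⟨f', hf'⟩ * q ⟨g', hg'⟩ := by
  rw [← map_mul, ← map_mul]
  exact congrArg q (Subtype.ext h)

theorem q_eq3 {f g k f' g' k' : PMap} (hf : f ∈ GeoAC) (hg : g ∈ GeoAC) (hk : k ∈ GeoAC)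
    (hf' : f' ∈ GeoAC) (hg' : g' ∈ GeoAC) (hk' : k' ∈ GeoAC) (h : f * g * k = f' * g' * k') :
    q ⟨f, hf⟩ * q ⟨g, hg⟩ * q ⟨k, hk⟩ = q ⟨f', hf'⟩ * q ⟨g', hg'⟩ * q ⟨k', hk'⟩ := by
  rw [← map_mul, ← map_mul, ← map_mul, ← map_mul]
  exact congrArg q (Subtype.ext h)

def gF : GenAC → G
  | .A α => qX q false α
  | .C α => qX q true α

theorem gF_ok (hiff : ∀ f g : GeoAC, q f = q g ↔ NearEq f.1 g.1) :
    ∀ r ∈ relsAC, FreeGroup.lift (gF q) r = 1 := by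
  have hinv : ∀ α, (qX q false α)⁻¹ = qAi q α := fun α =>
    inv_eq_of_mul_eq_one_right (qA_mul_qAi q hiff α)
  refine lift_ok (gF q) (qX q) (fun _ => rfl) (fun _ => rfl) ?_ ?_ ?_ ?_ ?_ ?_ ?_ ?_ ?_
    (qCC q hiff)
  · intro γ b b' α β
    apply q_eq2
    rw [at_append, at_append, ← at_mul, ← at_mul, comm_maps]
  · intro γ b α
    apply q_eq2
    rw [at_append, at_append, ← at_mul, ← at_mul, opX.eq_1, A11_maps]
  · intro γ b α
    apply q_eq2
    rw [at_append, at_append, ← at_mul, ← at_mul, opX.eq_1, A10_maps]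
  · intro γ b α
    apply q_eq2
    rw [at_append, at_append, ← at_mul, ← at_mul, opX.eq_1, A0_maps]
  · intro γ b α
    apply q_eq2
    rw [at_append, at_append, ← at_mul, ← at_mul, opX.eq_2, C0_maps]
  · intro γ b α
    apply q_eq2
    rw [at_append, at_append, ← at_mul, ← at_mul, opX.eq_2, C1_maps]
  · intro γ
    unfold qX
    rw [← map_mul, ← map_mul, ← map_mul]
    refine congrArg q (Subtype.ext ?_)
    show applyAt γ opA * applyAt γ opA =
      applyAt (γ ++ [true]) opA * applyAt γ opA * applyAt (γ ++ [false]) opA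
    rw [at_append, at_append, ← at_mul, ← at_mul, ← at_mul, pent_maps]
  · intro γ
    apply q_eq3
    show applyAt γ opA * applyAt γ opC * applyAt γ opA =
      applyAt (γ ++ [true]) opC * applyAt γ opA * applyAt (γ ++ [false]) opC
    rw [at_append, at_append, ← at_mul, ← at_mul, ← at_mul, ← at_mul, hex_maps]
  · intro γ
    rw [hinv]
    apply q_eq3
    show applyAt γ opAi * applyAt γ opC * applyAt γ opAi =
      applyAt (γ ++ [false]) opC * applyAt γ opAi * applyAt (γ ++ [true]) opC
    rw [at_append, at_append, ← at_mul, ← at_mul, ← at_mul, ← at_mul, hex_maps']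

def phi (hiff : ∀ f g : GeoAC, q f = q g ↔ NearEq f.1 g.1) : P →* G :=
  PresentedGroup.toGroup (gF_ok q hiff)

theorem phi_pX (hiff : ∀ f g : GeoAC, q f = q g ↔ NearEq f.1 g.1) (b : Bool) (α : Addr) :
    phi q hiff (pX b α) = qX q b α := by
  cases b
  · exact PresentedGroup.toGroup.of _
  · exact PresentedGroup.toGroup.of _

theorem rel_X (b : Bool) (α : Addr) : Rel (applyAt α (opX b)) (pX b α) := by
  cases b
  · exact rel_A α
  · exact rel_C α

theorem exists_rep (hiff : ∀ f g : GeoAC, q f = q g ↔ NearEq f.1 g.1) (x : P) :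
    (∃ f : GeoAC, phi q hiff x = q f ∧ Rel f.1 x) ∧
      ∃ f : GeoAC, phi q hiff x⁻¹ = q f ∧ Rel f.1 x⁻¹ := by
  refine p_ind (p := fun x => (∃ f : GeoAC, phi q hiff x = q f ∧ Rel f.1 x) ∧
      ∃ f : GeoAC, phi q hiff x⁻¹ = q f ∧ Rel f.1 x⁻¹) ?_ ?_ ?_ ?_ x
  · intro b α
    refine ⟨⟨⟨_, memX b α⟩, phi_pX q hiff b α, rel_X b α⟩, ?_⟩
    cases b
    · refine ⟨⟨_, memAi α⟩, ?_, rel_Ai α⟩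
      rw [map_inv, phi_pX]
      exact inv_eq_of_mul_eq_one_right (qA_mul_qAi q hiff α)
    · have : (pC α)⁻¹ = pC α := inv_eq_of_mul_eq_one_right (rel_CC α)
      rw [this]
      exact ⟨⟨_, memX true α⟩, phi_pX q hiff true α, rel_X true α⟩
  · rw [inv_one]
    exact ⟨⟨1, by rw [map_one, map_one], rel_one⟩, ⟨1, by rw [map_one, map_one], rel_one⟩⟩
  · rintro x y ⟨⟨f, hf, rf⟩, ⟨f', hf', rf'⟩⟩ ⟨⟨g, hg, rg⟩, ⟨g', hg', rg'⟩⟩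
    refine ⟨⟨f * g, by rw [map_mul, map_mul, hf, hg], rel_mul rf rg⟩, ?_⟩
    rw [mul_inv_rev]
    exact ⟨g' * f', by rw [map_mul, map_mul, hf', hg'], rel_mul rg' rf'⟩
  · rintro x ⟨h1, h2⟩
    exact ⟨h2, by rw [inv_inv]; exact h1⟩

theorem phi_inj (hiff : ∀ f g : GeoAC, q f = q g ↔ NearEq f.1 g.1) :
    Function.Injective (phi q hiff) := by
  rw [injective_iff_map_eq_one]
  intro x hx
  obtain ⟨⟨f, hf, rf⟩, -⟩ := exists_rep q hiff x
  rw [hx, ← map_one q] at hf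
  exact eq_one_of_near f.2 rf ((hiff f 1).mp hf.symm)

theorem phi_surj (hsurj : Function.Surjective q)
    (hiff : ∀ f g : GeoAC, q f = q g ↔ NearEq f.1 g.1) :
    Function.Surjective (phi q hiff) := by
  have key : ∀ (f : PMap) (hf : f ∈ GeoAC), ∃ x, phi q hiff x = q ⟨f, hf⟩ := by
    intro f hf
    induction hf using Submonoid.closure_induction with
    | mem f h =>
      obtain ⟨α, rfl | rfl | rfl⟩ := h
      · exact ⟨_, phi_pX q hiff false α⟩
      · refine ⟨(pA α)⁻¹, ?_⟩
        rw [map_inv, phi_pX]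
        exact inv_eq_of_mul_eq_one_right (qA_mul_qAi q hiff α)
      · exact ⟨_, phi_pX q hiff true α⟩
    | one => exact ⟨1, by rw [map_one]; exact (map_one q).symm⟩
    | mul f g hf hg h1 h2 =>
      obtain ⟨x, hx⟩ := h1
      obtain ⟨y, hy⟩ := h2
      refine ⟨x * y, ?_⟩
      rw [map_mul, hx, hy, ← map_mul]
      rfl
  intro g
  obtain ⟨⟨f, hf⟩, rfl⟩ := hsurj g
  exact key f hf

end

end ACProof

/-- Proposition 3.18: the relations `R_AC` completed with the torsion relations
`C_α² = 1` make a presentation of the geometry group `G(A,C)` — i.e. of any group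
`G` obtained from the geometry monoid `𝒢(A,C)` by identifying near-equal elements
(such a `G` is isomorphic to Thompson's group `V`) — in terms of the generators
`A_α` and `C_α`. -/
theorem stmt14 (G : Type*) [Group G] (q : GeoAC →* G)
    (hsurj : Function.Surjective q)
    (hiff : ∀ f g : GeoAC, q f = q g ↔ NearEq f.1 g.1) :
    ∃ iso : PresentedGroup relsAC ≃* G,
      ∀ α : Addr,
        iso (PresentedGroup.of (GenAC.A α)) = q ⟨applyAt α opA, memA α⟩ ∧
        iso (PresentedGroup.of (GenAC.C α)) = q ⟨applyAt α opC, memC α⟩ := by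
  exact ⟨MulEquiv.ofBijective (ACProof.phi q hiff)
      ⟨ACProof.phi_inj q hiff, ACProof.phi_surj q hsurj hiff⟩,
    fun α => ⟨ACProof.phi_pX q hiff false α, ACProof.phi_pX q hiff true α⟩⟩
end

section
/- In the group B•, define x[y] = x·∂y·σ₁·(∂x)⁻¹ and x∘y = x·∂y·a₁ for x, y ∈ B•. Then the bracket operation is left self-distributive, i.e., x[y[z]] = x[y][x[z]] for all x, y, z ∈ B•, and left cancellative, i.e., x[y] = x[z] implies y = z; moreover the mixed relations x[y[z]] = (x∘y)[z] and x[y∘z] = x[y]∘x[z] hold for all x, y, z ∈ B•. -/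
/-- Formal generators `a_{n+1}`, `σ_{n+1}` of the group `B•` (index `n : ℕ`
stands for subscript `n+1`). -/
inductive GenB : Type
  | a : ℕ → GenB
  | σ : ℕ → GenB

def ga (n : ℕ) : FreeGroup GenB := FreeGroup.of (GenB.a n)
def gσ (n : ℕ) : FreeGroup GenB := FreeGroup.of (GenB.σ n)

/-- `gx b n` is `a` for `b = false` and `σ` for `b = true`. -/
def gx : Bool → ℕ → FreeGroup GenB
  | false, n => ga n
  | true, n => gσ n

/-- The defining relations of `B•`, as relators (index `n` stands for subscript
`i = n+1`, and `j = i+2+k`): `a_i·x_{j-1} = x_j·a_i` and `σ_i·x_j = x_j·σ_i` for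
`j ≥ i+2` and `x ∈ {a, σ}`; `σ_i·σ_{i+1}·σ_i = σ_{i+1}·σ_i·σ_{i+1}`;
`σ_{i+1}·σ_i·a_{i+1} = a_i·σ_i`; and `σ_i·σ_{i+1}·a_i = a_{i+1}·σ_i`. -/
def relsB : Set (FreeGroup GenB) :=
  {x | (∃ (b : Bool) (n k : ℕ),
      x = ga n * gx b (n + 1 + k) * (gx b (n + 2 + k) * ga n)⁻¹) ∨
    (∃ (b : Bool) (n k : ℕ),
      x = gσ n * gx b (n + 2 + k) * (gx b (n + 2 + k) * gσ n)⁻¹) ∨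
    (∃ n : ℕ, x = gσ n * gσ (n + 1) * gσ n * (gσ (n + 1) * gσ n * gσ (n + 1))⁻¹) ∨
    (∃ n : ℕ, x = gσ (n + 1) * gσ n * ga (n + 1) * (ga n * gσ n)⁻¹) ∨
    (∃ n : ℕ, x = gσ n * gσ (n + 1) * ga n * (ga (n + 1) * gσ n)⁻¹)}

/-- The group `B•`. -/
abbrev Bdot : Type := PresentedGroup relsB

/-- The generator `a_{n+1}` of `B•`. -/
def ba (n : ℕ) : Bdot := PresentedGroup.of (GenB.a n)

/-- The generator `σ_{n+1}` of `B•`. -/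
def bσ (n : ℕ) : Bdot := PresentedGroup.of (GenB.σ n)

/-- The bracket operation on `B•` relative to the shift endomorphism `D`:
`x[y] = x·∂y·σ₁·(∂x)⁻¹`. -/
def br (D : Bdot →* Bdot) (x y : Bdot) : Bdot := x * D y * bσ 0 * (D x)⁻¹

/-- The circle operation on `B•` relative to the shift endomorphism `D`:
`x∘y = x·∂y·a₁`. -/
def cir (D : Bdot →* Bdot) (x y : Bdot) : Bdot := x * D y * ba 0


/-- `a` for `false`, `σ` for `true`. -/
def bx : Bool → ℕ → Bdot
  | false, n => ba n
  | true, n => bσ n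

theorem mk_ga (n : ℕ) : PresentedGroup.mk relsB (ga n) = ba n := rfl
theorem mk_gσ (n : ℕ) : PresentedGroup.mk relsB (gσ n) = bσ n := rfl
theorem mk_gx (b : Bool) (n : ℕ) : PresentedGroup.mk relsB (gx b n) = bx b n := by
  cases b <;> rfl

theorem rel_eq {u v : FreeGroup GenB} (h : u * v⁻¹ ∈ relsB) :
    PresentedGroup.mk relsB u = PresentedGroup.mk relsB v := by
  have h1 : PresentedGroup.mk relsB (u * v⁻¹) = 1 := PresentedGroup.one_of_mem h
  rw [map_mul, map_inv] at h1
  exact mul_inv_eq_one.mp h1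

theorem rel_ax (b : Bool) (n k : ℕ) : ba n * bx b (n + 1 + k) = bx b (n + 2 + k) * ba n := by
  have := rel_eq (Or.inl ⟨b, n, k, rfl⟩)
  simpa only [map_mul, mk_ga, mk_gσ, mk_gx] using this

theorem rel_sx (b : Bool) (n k : ℕ) : bσ n * bx b (n + 2 + k) = bx b (n + 2 + k) * bσ n := by
  have := rel_eq (Or.inr (Or.inl ⟨b, n, k, rfl⟩))
  simpa only [map_mul, mk_ga, mk_gσ, mk_gx] using this

theorem rel_sss (n : ℕ) : bσ n * bσ (n + 1) * bσ n = bσ (n + 1) * bσ n * bσ (n + 1) := by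
  have := rel_eq (Or.inr (Or.inr (Or.inl ⟨n, rfl⟩)))
  simpa only [map_mul, mk_ga, mk_gσ, mk_gx] using this

theorem rel_ssa (n : ℕ) : bσ (n + 1) * bσ n * ba (n + 1) = ba n * bσ n := by
  have := rel_eq (Or.inr (Or.inr (Or.inr (Or.inl ⟨n, rfl⟩))))
  simpa only [map_mul, mk_ga, mk_gσ, mk_gx] using this

theorem rel_ssa' (n : ℕ) : bσ n * bσ (n + 1) * ba n = ba (n + 1) * bσ n := by
  have := rel_eq (Or.inr (Or.inr (Or.inr (Or.inr ⟨n, rfl⟩))))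
  simpa only [map_mul, mk_ga, mk_gσ, mk_gx] using this

/-- Universal property of `B•`. -/
theorem exists_hom {H : Type} [Group H] (f : Bool → ℕ → H)
    (h1 : ∀ b n k, f false n * f b (n + 1 + k) = f b (n + 2 + k) * f false n)
    (h2 : ∀ b n k, f true n * f b (n + 2 + k) = f b (n + 2 + k) * f true n)
    (h3 : ∀ n, f true n * f true (n + 1) * f true n
      = f true (n + 1) * f true n * f true (n + 1))
    (h4 : ∀ n, f true (n + 1) * f true n * f false (n + 1) = f false n * f true n)
    (h5 : ∀ n, f true n * f true (n + 1) * f false n = f false (n + 1) * f true n) :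
    ∃ φ : Bdot →* H, (∀ n, φ (ba n) = f false n) ∧ (∀ n, φ (bσ n) = f true n) := by
  let g : GenB → H := fun x => match x with
    | GenB.a n => f false n
    | GenB.σ n => f true n
  have ha : ∀ n, FreeGroup.lift g (ga n) = f false n := fun n => FreeGroup.lift_apply_of
  have hs : ∀ n, FreeGroup.lift g (gσ n) = f true n := fun n => FreeGroup.lift_apply_of
  have hx : ∀ b n, FreeGroup.lift g (gx b n) = f b n := by
    intro b n
    cases b
    · exact ha n
    · exact hs n
  have hr : ∀ r ∈ relsB, FreeGroup.lift g r = 1 := by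
    rintro r (⟨b, n, k, rfl⟩ | ⟨b, n, k, rfl⟩ | ⟨n, rfl⟩ | ⟨n, rfl⟩ | ⟨n, rfl⟩) <;>
      rw [map_mul, map_inv, mul_inv_eq_one] <;> simp only [map_mul, ha, hs, hx]
    · exact h1 b n k
    · exact h2 b n k
    · exact h3 n
    · exact h4 n
    · exact h5 n
  exact ⟨PresentedGroup.toGroup hr, fun n => PresentedGroup.toGroup.of hr,
    fun n => PresentedGroup.toGroup.of hr⟩

theorem Bdot_induction {P : Bdot → Prop} (h1 : P 1) (ha : ∀ n, P (ba n)) (hs : ∀ n, P (bσ n))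
    (hm : ∀ x y, P x → P y → P (x * y)) (hi : ∀ x, P x → P x⁻¹) (x : Bdot) : P x := by
  induction x using PresentedGroup.induction_on with
  | _ z =>
    have hof : ∀ i : GenB, P (PresentedGroup.mk relsB (FreeGroup.of i)) := by
      rintro (n | n)
      · exact ha n
      · exact hs n
    induction z using FreeGroup.induction_on with
    | C1 => rw [map_one]; exact h1
    | of i => exact hof i
    | inv_of i _ => rw [map_inv]; exact hi _ (hof i)
    | mul u v hu hv => rw [map_mul]; exact hm _ _ hu hv

/-- `δ_n = σ_1 ⋯ σ_n`. -/
def dl : ℕ → Bdot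
  | 0 => 1
  | n + 1 => dl n * bσ n

theorem dl_comm (b : Bool) (n k : ℕ) : bx b (n + 1 + k) * dl n = dl n * bx b (n + 1 + k) := by
  induction n generalizing k with
  | zero => simp [dl]
  | succ n ih =>
    have e : n + 1 + 1 + k = n + 1 + (k + 1) := by omega
    have e2 : n + 1 + (k + 1) = n + 2 + k := by omega
    rw [dl, e, ← mul_assoc, ih (k + 1), mul_assoc, mul_assoc, e2, rel_sx]

theorem dl_sigma (i k : ℕ) : bσ (i + 1) * dl (i + 2 + k) = dl (i + 2 + k) * bσ i := by
  induction k with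
  | zero =>
    have h := dl_comm true i 0
    simp only [bx, add_zero] at h
    calc bσ (i + 1) * (dl i * bσ i * bσ (i + 1))
        = (bσ (i + 1) * dl i) * bσ i * bσ (i + 1) := by group
      _ = dl i * (bσ (i + 1) * bσ i * bσ (i + 1)) := by rw [h]; group
      _ = dl i * bσ i * bσ (i + 1) * bσ i := by rw [← rel_sss]; group
  | succ k ih =>
    have h := rel_sx true i k
    simp only [bx] at h
    rw [← add_assoc, dl, ← mul_assoc, ih, mul_assoc, mul_assoc, h]

theorem dl_a (i k : ℕ) : ba (i + 1) * dl (i + 1 + k) = dl (i + 1 + k + 1) * ba i := by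
  induction k with
  | zero =>
    have h := dl_comm false i 0
    simp only [bx, add_zero] at h
    calc ba (i + 1) * (dl i * bσ i)
        = (ba (i + 1) * dl i) * bσ i := by group
      _ = dl i * (ba (i + 1) * bσ i) := by rw [h]; group
      _ = dl i * bσ i * bσ (i + 1) * ba i := by rw [← rel_ssa']; group
  | succ k ih =>
    have h := rel_ax true i k
    simp only [bx] at h
    have e : i + 2 + k = i + 1 + k + 1 := by omega
    rw [e] at h
    rw [← add_assoc, dl, ← mul_assoc, ih, mul_assoc, h, ← mul_assoc]
    rfl

/-- Any element is conjugated to its shift by the `δ_n`, up to the homological drift `χ`. -/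
theorem key (D : Bdot →* Bdot) (hDa : ∀ n, D (ba n) = ba (n + 1))
    (hDs : ∀ n, D (bσ n) = bσ (n + 1)) (χ : Bdot →* Multiplicative ℤ)
    (ca : ∀ n, χ (ba n) = Multiplicative.ofAdd 1) (cs : ∀ n, χ (bσ n) = 1) (x : Bdot) :
    ∃ p q N : ℕ, (χ (D x)).toAdd + p = q ∧ ∀ n, N ≤ n → D x * dl (n + p) = dl (n + q) * x := by
  induction x using Bdot_induction with
  | h1 => exact ⟨0, 0, 0, by simp, by simp⟩
  | ha i =>
    refine ⟨0, 1, i + 1, by simp [hDa, ca], fun n hn => ?_⟩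
    obtain ⟨k, rfl⟩ := Nat.exists_eq_add_of_le hn
    rw [hDa]
    exact dl_a i k
  | hs i =>
    refine ⟨0, 0, i + 2, by simp [hDs, cs], fun n hn => ?_⟩
    obtain ⟨k, rfl⟩ := Nat.exists_eq_add_of_le hn
    rw [hDs]
    exact dl_sigma i k
  | hm x y hx hy =>
    obtain ⟨p, q, N, h, H⟩ := hx
    obtain ⟨p', q', N', h', H'⟩ := hy
    refine ⟨p + p', q + q', N + N', ?_, fun n hn => ?_⟩
    · rw [map_mul, map_mul, toAdd_mul]; push_cast; linarith
    · rw [map_mul, mul_assoc, ← add_assoc, H' (n + p) (by omega), ← mul_assoc,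
        add_right_comm, H (n + q') (by omega), mul_assoc, add_right_comm, add_assoc]
  | hi x hx =>
    obtain ⟨p, q, N, h, H⟩ := hx
    refine ⟨q, p, N, ?_, fun n hn => ?_⟩
    · rw [map_inv, map_inv, toAdd_inv]; linarith
    · rw [map_inv, inv_mul_eq_iff_eq_mul, ← mul_assoc, H n hn, mul_inv_cancel_right]

theorem shift_inj (D : Bdot →* Bdot) (hDa : ∀ n, D (ba n) = ba (n + 1))
    (hDs : ∀ n, D (bσ n) = bσ (n + 1)) : Function.Injective D := by
  obtain ⟨χ, ca, cs⟩ := exists_hom (H := Multiplicative ℤ)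
    (fun b _ => if b then 1 else Multiplicative.ofAdd 1)
    (fun b n k => mul_comm _ _) (fun b n k => mul_comm _ _) (by simp) (by simp) (by simp)
  rw [injective_iff_map_eq_one]
  intro x hx
  obtain ⟨p, q, N, h, H⟩ := key D hDa hDs χ (by simpa using ca) (by simpa using cs) x
  have hpq : p = q := by
    rw [hx] at h
    simpa using h
  subst hpq
  have := H N le_rfl
  rw [hx, one_mul] at this
  exact (left_eq_mul.mp this)

/-- Proposition 5.9: in `B•`, with `∂` the endomorphism determined by
`∂a_i = a_{i+1}` and `∂σ_i = σ_{i+1}`, the bracket operation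
`x[y] = x·∂y·σ₁·(∂x)⁻¹` is left self-distributive and left cancellative, and the
mixed relations `x[y[z]] = (x∘y)[z]` and `x[y∘z] = x[y]∘x[z]` hold, where
`x∘y = x·∂y·a₁`. -/
theorem stmt19 :
    ∃ D : Bdot →* Bdot,
      (∀ n : ℕ, D (ba n) = ba (n + 1)) ∧
      (∀ n : ℕ, D (bσ n) = bσ (n + 1)) ∧
      (∀ x y z : Bdot, br D x (br D y z) = br D (br D x y) (br D x z)) ∧
      (∀ x y z : Bdot, br D x y = br D x z → y = z) ∧
      (∀ x y z : Bdot, br D x (br D y z) = br D (cir D x y) z) ∧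
      (∀ x y z : Bdot, br D x (cir D y z) = cir D (br D x y) (br D x z)) := by
  obtain ⟨D, hDa, hDs⟩ := exists_hom (H := Bdot) (fun b n => bx b (n + 1))
    (fun b n k => by
      have := rel_ax b (n + 1) k
      rwa [show n + 1 + 1 + k = n + 1 + k + 1 by omega,
        show n + 1 + 2 + k = n + 2 + k + 1 by omega] at this)
    (fun b n k => by
      have := rel_sx b (n + 1) k
      rwa [show n + 1 + 2 + k = n + 2 + k + 1 by omega] at this)
    (fun n => rel_sss (n + 1)) (fun n => rel_ssa (n + 1)) (fun n => rel_ssa' (n + 1))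
  simp only [bx] at hDa hDs
  have hS : ∀ x, bσ 0 * D (D x) = D (D x) * bσ 0 := by
    intro x
    change Commute (bσ 0) (D (D x))
    induction x using Bdot_induction with
    | h1 => simp
    | ha i =>
      rw [hDa, hDa]
      have := rel_sx false 0 i
      rwa [show 0 + 2 + i = i + 1 + 1 by omega] at this
    | hs i =>
      rw [hDs, hDs]
      have := rel_sx true 0 i
      rwa [show 0 + 2 + i = i + 1 + 1 by omega] at this
    | hm x y hx hy => rw [map_mul, map_mul]; exact hx.mul_right hy
    | hi x hx => rw [map_inv, map_inv]; exact hx.inv_right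
  have hA : ∀ x, ba 0 * D x = D (D x) * ba 0 := by
    intro x
    change SemiconjBy (ba 0) (D x) (D (D x))
    induction x using Bdot_induction with
    | h1 => simp
    | ha i =>
      rw [hDa, hDa]
      have := rel_ax false 0 i
      rwa [show 0 + 2 + i = i + 1 + 1 by omega, show 0 + 1 + i = i + 1 by omega] at this
    | hs i =>
      rw [hDs, hDs]
      have := rel_ax true 0 i
      rwa [show 0 + 2 + i = i + 1 + 1 by omega, show 0 + 1 + i = i + 1 by omega] at this
    | hm x y hx hy => rw [map_mul, map_mul]; exact hx.mul_right hy
    | hi x hx => rw [map_inv, map_inv]; exact hx.inv_right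
  have hSi : ∀ x, (D (D x))⁻¹ * bσ 0 = bσ 0 * (D (D x))⁻¹ := by
    intro x
    have := hS x⁻¹
    rw [map_inv, map_inv] at this
    exact this.symm
  have hAi : ∀ x, (D (D x))⁻¹ * ba 0 = ba 0 * (D x)⁻¹ := by
    intro x
    have := hA x⁻¹
    rw [map_inv, map_inv] at this
    exact this.symm
  have h3 := rel_sss 0
  have h4 := rel_ssa 0
  have h5 := rel_ssa' 0
  simp only [zero_add] at h3 h4 h5
  -- common normal form of `x[y[z]]`
  have hL : ∀ x y z, br D x (br D y z)
      = x * D y * D (D z) * (bσ 1 * bσ 0) * (D (D y))⁻¹ * (D x)⁻¹ := by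
    intro x y z
    simp only [br, map_mul, map_inv, hDs, zero_add]
    calc x * (D y * D (D z) * bσ 1 * (D (D y))⁻¹) * bσ 0 * (D x)⁻¹
        = x * D y * D (D z) * bσ 1 * ((D (D y))⁻¹ * bσ 0) * (D x)⁻¹ := by group
      _ = _ := by rw [hSi]; group
  refine ⟨D, hDa, hDs, ?_, ?_, ?_, ?_⟩
  · intro x y z
    rw [hL]
    simp only [br, map_mul, map_inv, hDs, zero_add]
    have e1 : bσ 1 * bσ 0 = bσ 0 * bσ 1 * bσ 0 * (bσ 1)⁻¹ := by rw [h3]; group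
    symm
    calc x * D y * bσ 0 * (D x)⁻¹ * (D x * D (D z) * bσ 1 * (D (D x))⁻¹) * bσ 0 *
          (D x * D (D y) * bσ 1 * (D (D x))⁻¹)⁻¹
        = x * D y * (bσ 0 * D (D z)) * bσ 1 * ((D (D x))⁻¹ * bσ 0) * D (D x) * (bσ 1)⁻¹
          * (D (D y))⁻¹ * (D x)⁻¹ := by group
      _ = x * D y * D (D z) * (bσ 0 * bσ 1 * bσ 0 * (bσ 1)⁻¹)
          * (D (D y))⁻¹ * (D x)⁻¹ := by rw [hSi, hS]; group
      _ = _ := by rw [← e1]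
  · intro x y z h
    simp only [br] at h
    exact shift_inj D hDa hDs (mul_left_cancel (mul_right_cancel (mul_right_cancel h)))
  · intro x y z
    rw [hL]
    simp only [br, cir, map_mul, hDa, zero_add]
    have e1 : bσ 1 * bσ 0 = ba 0 * bσ 0 * (ba 1)⁻¹ := by rw [← h4]; group
    symm
    calc x * D y * ba 0 * D z * bσ 0 * (D x * D (D y) * ba 1)⁻¹
        = x * D y * (ba 0 * D z) * bσ 0 * (ba 1)⁻¹ * (D (D y))⁻¹ * (D x)⁻¹ := by group
      _ = x * D y * D (D z) * (ba 0 * bσ 0 * (ba 1)⁻¹) * (D (D y))⁻¹ * (D x)⁻¹ := by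
          rw [hA]; group
      _ = _ := by rw [← e1]
  · intro x y z
    simp only [br, cir, map_mul, map_inv, hDa, hDs, zero_add]
    symm
    calc x * D y * bσ 0 * (D x)⁻¹ * (D x * D (D z) * bσ 1 * (D (D x))⁻¹) * ba 0
        = x * D y * (bσ 0 * D (D z)) * bσ 1 * ((D (D x))⁻¹ * ba 0) := by group
      _ = x * D y * D (D z) * (bσ 0 * bσ 1 * ba 0) * (D x)⁻¹ := by rw [hS, hAi]; group
      _ = _ := by rw [h5]; group
end
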